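/- arXiv:2109.08579 — 2 statements merged into one kernel-verified Lean document; each statement's English description precedes it below -/
import Mathlib

section
/- Let $T\ge 0$ be an integer and let $a_{0,\ell},a_{1,\ell}$ ($0\le \ell\le T$) be real numbers, not all equal to zero. For a $T$-times continuously differentiable function $f:\mathbb{R}\to\mathbb{R}$ put $\mathcal{S}f(y)=\sum_{\ell=0}^T (a_{0,\ell}+a_{1,\ell}y)\,f^{(\ell)}(y)$. Let $Y$ be a real-valued random variable whose law is absolutely continuous with respect to Lebesgue measure and which satisfies $\mathbb{E}|Y|<\infty$. Let $\mathcal{F}_{\mathcal{S},Y}$ be the set of all $T$-times continuously differentiable functions $f:\mathbb{R}\to\mathbb{R}$ such that $\mathbb{E}|Y^j f^{(t)}(Y)|<\infty$ for all $t=0,\dots,T$ and $j=0,1$. Suppose that $\mathbb{E}[\mathcal{S}f(Y)]=0$ for all $f\in\mathcal{F}_{\mathcal{S},Y}$. If $W$ is a real-valued random variable with $\mathbb{E}|W|<\infty$ such that $\mathbb{E}[\mathcal{S}f(W)]=0$ for all $f\in\mathcal{F}_{\mathcal{S},Y}$, then $W$ is equal in law to $Y$. -/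
open MeasureTheory

/-- The differential operator with linear coefficients
`S f (y) = ∑_{ℓ = 0}^{T} (a₀ ℓ + a₁ ℓ * y) * f^(ℓ)(y)`. -/
noncomputable def steinLin (T : ℕ) (a₀ a₁ : ℕ → ℝ) (f : ℝ → ℝ) (y : ℝ) : ℝ :=
  ∑ l ∈ Finset.range (T + 1), (a₀ l + a₁ l * y) * iteratedDeriv l f y

/-- Membership in the class `F_{S,Y}` for coefficients of maximal degree `m = 1`:
`f` is `T`-times continuously differentiable and `E|Y^j f^(t)(Y)| < ∞` for all
`t = 0, …, T` and `j = 0, 1`. The functions are taken on all of `ℝ`, so that `S f (W)` makes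
sense for every real random variable `W`. If `Y` is supported on `I`, restriction to `I` sends
this class into the class of such functions on `I`; hence a condition tested on the present class
is implied by the same condition tested on functions on `I`. -/
def memFlin {Ω : Type*} [MeasurableSpace Ω] (μ : Measure Ω) (Y : Ω → ℝ) (T : ℕ)
    (f : ℝ → ℝ) : Prop :=
  ContDiff ℝ (T : ℕ∞) f ∧
    ∀ t ≤ T, ∀ j ≤ 1, Integrable (fun ω => (Y ω) ^ j * iteratedDeriv t f (Y ω)) μ

open Filter Topology Complex ProbabilityTheory

/-- If the characteristic function of a finite measure is twice continuously differentiable at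
the origin, then the measure has a finite second moment. -/
theorem integrable_sq_of_contDiffAt_charFun {m : Measure ℝ} [IsFiniteMeasure m]
    (h : ContDiffAt ℝ 2 (charFun m) 0) : Integrable (fun x : ℝ => x ^ 2) m := by
  set f : ℝ → ℝ := fun t => (charFun m t).re with hf
  have hfc : ContDiffAt ℝ 2 f 0 := reCLM.contDiff.contDiffAt.comp 0 h
  have hfi : ∀ t, f t = ∫ x, Real.cos (t * x) ∂m := by
    intro t
    have hint : Integrable (fun x : ℝ => cexp (t * x * I)) m := by
      refine Integrable.of_bound (by fun_prop) 1 (ae_of_all _ fun x => ?_)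
      rw [← ofReal_mul, norm_exp_ofReal_mul_I]
    rw [hf]
    simp only [charFun_apply_real]
    rw [← RCLike.re_eq_complex_re, ← integral_re hint]
    refine integral_congr_ae (ae_of_all _ fun x => ?_)
    simp only [RCLike.re_eq_complex_re]
    rw [← ofReal_mul, exp_ofReal_mul_I_re]
  have hd0 : deriv f 0 = 0 := by
    have he : (fun t => f (-t)) = f := by
      funext t
      simp [hfi]
    have := deriv_comp_neg f 0
    rw [he, neg_zero] at this
    linarith
  obtain ⟨ε, hε, hcd⟩ : ∃ ε > 0, ContDiffOn ℝ 2 f (Set.Icc 0 ε) := by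
    obtain ⟨u, hu, hcu⟩ := hfc.contDiffOn (m := 2) le_rfl (by simp)
    obtain ⟨ε, hε, hb⟩ := Metric.nhds_basis_closedBall.mem_iff.1 hu
    refine ⟨ε, hε, hcu.mono fun x hx => hb ?_⟩
    simp [abs_of_nonneg hx.1, hx.2]
  obtain ⟨C, hC⟩ := exists_taylor_mean_remainder_bound (n := 1) hε.le (by exact_mod_cast hcd)
  have hbound : ∀ t ∈ Set.Icc 0 ε, ∫ x, (1 - Real.cos (t * x)) ∂m ≤ C * t ^ 2 := by
    intro t ht
    have h1 := hC t ht
    have hdw : derivWithin f (Set.Icc 0 ε) 0 = 0 := by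
      rw [DifferentiableAt.derivWithin (hfc.differentiableAt (by simp)), hd0]
      exact uniqueDiffOn_Icc hε 0 ⟨le_rfl, hε.le⟩
    rw [taylorWithinEval_succ, taylor_within_zero_eval, iteratedDerivWithin_one, hdw] at h1
    simp only [smul_zero, add_zero, sub_zero, Nat.reduceAdd] at h1
    have hc : Integrable (fun x => Real.cos (t * x)) m :=
      Integrable.of_bound (by fun_prop) 1 (ae_of_all _ fun x => Real.abs_cos_le_one _)
    rw [integral_sub (integrable_const _) hc, ← hfi]
    have h0 : f 0 = ∫ _, (1 : ℝ) ∂m := by simp [hfi]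
    rw [← h0]
    have := (abs_le.1 h1).1
    linarith
  have hcov : AECover m atTop (fun N : ℕ => Metric.closedBall (0 : ℝ) N) :=
    aecover_closedBall tendsto_natCast_atTop_atTop
  refine hcov.integrable_of_integral_norm_bounded (Real.pi ^ 2 / 2 * C)
    (fun N => (continuous_pow 2).continuousOn.integrableOn_compact (isCompact_closedBall _ _)) ?_
  have hev : ∀ᶠ N : ℕ in atTop, (N : ℝ)⁻¹ ∈ Set.Icc 0 ε := by
    have ht : Tendsto (fun N : ℕ => (N : ℝ)⁻¹) atTop (𝓝 0) := tendsto_inv_atTop_nhds_zero_nat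
    filter_upwards [ht.eventually (ge_mem_nhds hε)] with N hN using ⟨by positivity, hN⟩
  filter_upwards [hev, eventually_gt_atTop 0] with N hN hN0
  have hNr : (0 : ℝ) < N := by exact_mod_cast hN0
  have hint : Integrable (fun x => 1 - Real.cos ((N : ℝ)⁻¹ * x)) m :=
    (integrable_const _).sub
      (Integrable.of_bound (by fun_prop) 1 (ae_of_all _ fun x => Real.abs_cos_le_one _))
  calc ∫ x in Metric.closedBall (0 : ℝ) N, ‖x ^ 2‖ ∂m
      ≤ ∫ x in Metric.closedBall (0 : ℝ) N,
          Real.pi ^ 2 / 2 * N ^ 2 * (1 - Real.cos ((N : ℝ)⁻¹ * x)) ∂m := by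
        refine setIntegral_mono_on
          (((continuous_pow 2).norm).continuousOn.integrableOn_compact (isCompact_closedBall _ _))
          (hint.const_mul _).integrableOn Metric.isClosed_closedBall.measurableSet fun x hx => ?_
        have hx' : |x| ≤ N := by simpa using hx
        have hux : |(N : ℝ)⁻¹ * x| ≤ Real.pi := by
          rw [abs_mul, abs_of_pos (inv_pos.2 hNr)]
          calc (N : ℝ)⁻¹ * |x| ≤ (N : ℝ)⁻¹ * N := by gcongr
            _ = 1 := inv_mul_cancel₀ hNr.ne'
            _ ≤ Real.pi := by linarith [Real.pi_gt_three]
        have hq := Real.cos_le_one_sub_mul_cos_sq hux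
        rw [Real.norm_of_nonneg (by positivity)]
        have hpi := Real.pi_pos
        calc x ^ 2 = Real.pi ^ 2 / 2 * N ^ 2 * (2 / Real.pi ^ 2 * ((N : ℝ)⁻¹ * x) ^ 2) := by
              field_simp
          _ ≤ _ := by gcongr; linarith
    _ ≤ ∫ x, Real.pi ^ 2 / 2 * N ^ 2 * (1 - Real.cos ((N : ℝ)⁻¹ * x)) ∂m := by
        refine setIntegral_le_integral (hint.const_mul _) (ae_of_all _ fun x => ?_)
        have := Real.cos_le_one ((N : ℝ)⁻¹ * x)
        have : 0 ≤ 1 - Real.cos ((N : ℝ)⁻¹ * x) := by linarith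
        simp only [Pi.zero_apply]
        positivity
    _ ≤ Real.pi ^ 2 / 2 * N ^ 2 * (C * (N : ℝ)⁻¹ ^ 2) := by
        rw [integral_const_mul]
        gcongr
        exact hbound _ hN
    _ = Real.pi ^ 2 / 2 * C := by field_simp


theorem memLp_id_two_mul_of_integrable_pow {m : Measure ℝ} {n : ℕ}
    (h : Integrable (fun x : ℝ => x ^ (2 * n)) m) : MemLp id ((2 * n : ℕ) : ENNReal) m := by
  rcases Nat.eq_zero_or_pos n with rfl | hn
  · simpa using (by fun_prop : AEStronglyMeasurable id m)
  · rw [← integrable_norm_rpow_iff (by fun_prop) (Nat.cast_ne_zero.2 (by omega))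
      (ENNReal.natCast_ne_top _)]
    refine h.congr (ae_of_all _ fun x => ?_)
    simp only [ENNReal.toReal_natCast, Real.rpow_natCast, id, Real.norm_eq_abs,
      (even_two_mul n).pow_abs]

/-- A finite measure on the line whose characteristic function is real analytic at the origin has
finite moments of all even orders. -/
theorem integrable_pow_two_mul_of_analyticAt_charFun {m : Measure ℝ} [IsFiniteMeasure m]
    (h : AnalyticAt ℝ (charFun m) 0) (n : ℕ) : Integrable (fun x : ℝ => x ^ (2 * n)) m := by
  induction n with
  | zero => simp
  | succ n ih =>
    have hmem := memLp_id_two_mul_of_integrable_pow ih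
    set d : ℝ → NNReal := fun x => Real.toNNReal (x ^ (2 * n)) with hd
    have hdm : Measurable d := by fun_prop
    have hdc : ∀ x, (d x : ℝ) = x ^ (2 * n) := fun x =>
      Real.coe_toNNReal _ ((even_two_mul n).pow_nonneg x)
    set m' := m.withDensity (fun x => (d x : ENNReal)) with hm'
    have hfin : IsFiniteMeasure m' := isFiniteMeasure_withDensity_ofReal ih.2
    have hchar : charFun m' = fun t => (I ^ (2 * n))⁻¹ * iteratedDeriv (2 * n) (charFun m) t := by
      funext t
      rw [iteratedDeriv_charFun hmem, inv_mul_cancel_left₀ (pow_ne_zero _ I_ne_zero),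
        charFun_apply_real, hm', integral_withDensity_eq_integral_smul hdm]
      refine integral_congr_ae (ae_of_all _ fun x => ?_)
      simp only [NNReal.smul_def, hdc, real_smul, ofReal_pow]
    have hana : AnalyticAt ℝ (charFun m') 0 := by
      rw [hchar, iteratedDeriv_eq_iterate]
      exact analyticAt_const.mul (h.iterated_deriv _)
    have hint := integrable_sq_of_contDiffAt_charFun hana.contDiffAt
    rw [hm', integrable_withDensity_iff_integrable_smul hdm] at hint
    refine hint.congr (ae_of_all _ fun x => ?_)
    simp only [NNReal.smul_def, hdc, smul_eq_mul]
    ring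

/-- A finite measure on the line whose characteristic function is real analytic at the origin has
finite exponential moments near the origin. -/
theorem zero_mem_interior_integrableExpSet_of_analyticAt_charFun {m : Measure ℝ}
    [IsFiniteMeasure m] (h : AnalyticAt ℝ (charFun m) 0) :
    0 ∈ interior (integrableExpSet id m) := by
  have hint := integrable_pow_two_mul_of_analyticAt_charFun h
  obtain ⟨p, R, hp⟩ := h
  obtain ⟨r, hr0, hrR⟩ := ENNReal.lt_iff_exists_nnreal_btwn.1 hp.r_pos
  have hr : 0 < r := by exact_mod_cast hr0
  obtain ⟨C, hC, hpC⟩ := p.norm_le_div_pow_of_pos_of_lt_radius hr (hrR.trans_le hp.r_le)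
  have hmom : ∀ n : ℕ, ∫ x, x ^ (2 * n) ∂m ≤ (2 * n).factorial * (C / r ^ (2 * n)) := by
    intro n
    have hmem := memLp_id_two_mul_of_integrable_pow (hint n)
    have h1 := iteratedDeriv_charFun_zero hmem
    rw [iteratedDeriv, ← hp.factorial_smul] at h1
    have h2 := congrArg norm h1
    rw [norm_mul, norm_pow, norm_I, one_pow, one_mul, norm_real, nsmul_eq_mul, norm_mul,
      norm_natCast] at h2
    refine (le_abs_self _).trans (h2.symm.le.trans ?_)
    gcongr
    refine (((p (2 * n)).le_opNorm _).trans ?_).trans (hpC (2 * n))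
    simp
  set s : ℝ := r / 2 with hs
  have hr' : (0 : ℝ) < r := hr
  have hcosh : Integrable (fun x => Real.cosh (s * x)) m := by
    have hsum : Summable fun n : ℕ => ∫ x, ‖(s * x) ^ (2 * n) / ((2 * n).factorial : ℝ)‖ ∂m := by
      refine Summable.of_nonneg_of_le (fun n => integral_nonneg fun x => norm_nonneg _)
        (fun n => ?_) ((summable_geometric_of_lt_one (r := (1 / 4 : ℝ)) (by norm_num)
          (by norm_num)).mul_left C)
      have : ∀ x : ℝ, ‖(s * x) ^ (2 * n) / ((2 * n).factorial : ℝ)‖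
          = s ^ (2 * n) / ((2 * n).factorial : ℝ) * x ^ (2 * n) := by
        intro x
        rw [Real.norm_of_nonneg (div_nonneg ((even_two_mul n).pow_nonneg _) (by positivity))]
        ring
      simp only [this]
      rw [integral_const_mul]
      calc s ^ (2 * n) / ((2 * n).factorial : ℝ) * ∫ x, x ^ (2 * n) ∂m
          ≤ s ^ (2 * n) / ((2 * n).factorial : ℝ) * ((2 * n).factorial * (C / r ^ (2 * n))) := by
            gcongr
            exact hmom n
        _ = C * (1 / 4) ^ n := by
            rw [hs, div_pow, pow_mul 2 2 n, one_div, inv_pow]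
            field_simp
            norm_num
    have hF : ∀ n : ℕ, Integrable (fun x => (s * x) ^ (2 * n) / ((2 * n).factorial : ℝ)) m := by
      intro n
      refine ((hint n).const_mul (s ^ (2 * n) / ((2 * n).factorial : ℝ))).congr
        (ae_of_all _ fun x => ?_)
      simp only
      ring
    refine ⟨by fun_prop, ?_⟩
    calc ∫⁻ x, ‖Real.cosh (s * x)‖ₑ ∂m
        ≤ ∫⁻ x, ∑' n : ℕ, ‖(s * x) ^ (2 * n) / ((2 * n).factorial : ℝ)‖ₑ ∂m := by
          refine lintegral_mono fun x => ?_
          rw [← (Real.hasSum_cosh (s * x)).tsum_eq]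
          exact enorm_tsum_le_tsum_enorm
      _ = ∑' n : ℕ, ENNReal.ofReal
            (∫ x, ‖(s * x) ^ (2 * n) / ((2 * n).factorial : ℝ)‖ ∂m) := by
          rw [lintegral_tsum fun n => (hF n).1.enorm]
          exact tsum_congr fun n => (ofReal_integral_norm_eq_lintegral_enorm (hF n)).symm
      _ < ⊤ := by
          rw [← ENNReal.ofReal_tsum_of_nonneg (fun n => integral_nonneg fun x => norm_nonneg _)
            hsum]
          exact ENNReal.ofReal_lt_top
  have hs0 : 0 < s := by positivity
  have hsub : Set.Icc (-s) s ⊆ integrableExpSet id m := by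
    intro t ht
    refine Integrable.mono' (hcosh.const_mul 2) (by fun_prop) (ae_of_all _ fun x => ?_)
    simp only [id, Real.norm_eq_abs, Real.abs_exp]
    calc Real.exp (t * x) ≤ Real.exp |s * x| := by
          refine Real.exp_le_exp.2 ((le_abs_self _).trans ?_)
          rw [abs_mul, abs_mul, abs_of_pos hs0]
          gcongr
          exact abs_le.2 ht
      _ ≤ 2 * Real.cosh |s * x| := by
          rw [Real.cosh_eq]
          have := Real.exp_pos (-|s * x|)
          linarith
      _ = _ := by rw [Real.cosh_abs]
  exact mem_interior_iff_mem_nhds.2 (Filter.mem_of_superset (Icc_mem_nhds (by linarith) hs0) hsub)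

/-- Two finite measures on the line with finite exponential moments near the origin and with
characteristic functions that coincide near the origin are equal. -/
theorem MeasureTheory.Measure.ext_of_charFun_eventuallyEq {m₁ m₂ : Measure ℝ} [IsFiniteMeasure m₁]
    [IsFiniteMeasure m₂] (h₁ : 0 ∈ interior (integrableExpSet id m₁))
    (h₂ : 0 ∈ interior (integrableExpSet id m₂)) (h : charFun m₁ =ᶠ[𝓝 0] charFun m₂) :
    m₁ = m₂ := by
  set J := interior (integrableExpSet id m₁) ∩ interior (integrableExpSet id m₂) with hJ
  have hJc : Convex ℝ J :=
    convex_integrableExpSet.interior.inter convex_integrableExpSet.interior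
  have hU : IsPreconnected {z : ℂ | z.re ∈ J} := (hJc.linear_preimage reLm).isPreconnected
  have hfreq : ∃ᶠ z in 𝓝[≠] (0 : ℂ), complexMGF id m₁ z = complexMGF id m₂ z := by
    have ht : Tendsto (fun t : ℝ => (t : ℂ) * I) (𝓝[≠] 0) (𝓝[≠] 0) := by
      refine tendsto_nhdsWithin_iff.2 ⟨?_, ?_⟩
      · have : Continuous fun t : ℝ => (t : ℂ) * I := by fun_prop
        simpa using (this.tendsto 0).mono_left nhdsWithin_le_nhds
      · filter_upwards [self_mem_nhdsWithin] with t ht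
        simpa using ht
    refine ht.frequently (Eventually.frequently ?_)
    filter_upwards [h.filter_mono nhdsWithin_le_nhds] with t ht
    rw [complexMGF_id_mul_I, complexMGF_id_mul_I, ht]
  have heq : Set.EqOn (complexMGF id m₁) (complexMGF id m₂) {z : ℂ | z.re ∈ J} :=
    AnalyticOnNhd.eqOn_of_preconnected_of_frequently_eq
      (fun z hz => analyticAt_complexMGF hz.1) (fun z hz => analyticAt_complexMGF hz.2) hU
      (z₀ := 0) (by simpa [hJ] using ⟨h₁, h₂⟩) hfreq
  refine Measure.ext_of_charFun (funext fun t => ?_)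
  rw [← complexMGF_id_mul_I, ← complexMGF_id_mul_I]
  exact heq (by simpa [hJ] using ⟨h₁, h₂⟩)

/-- Normalised continuously differentiable solutions of a first order linear differential equation
with polynomial coefficients are given near the origin by a common real analytic function, even
if the leading coefficient vanishes at the origin. -/
theorem exists_analyticAt_forall_eventuallyEq_of_linear_ode (P Q : Polynomial ℂ)
    (hPQ : P ≠ 0 ∨ Q ≠ 0) :
    ∃ F : ℝ → ℂ, AnalyticAt ℝ F 0 ∧ ∀ φ : ℝ → ℂ, ContDiff ℝ 1 φ → φ 0 = 1 →
      (∀ t : ℝ, P.eval (t : ℂ) * φ t + Q.eval (t : ℂ) * deriv φ t = 0) → φ =ᶠ[𝓝 0] F := by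
  set G := GCDMonoid.gcd P Q with hG
  have hG0 : G ≠ 0 := by
    rw [hG, Ne, gcd_eq_zero_iff]
    tauto
  obtain ⟨P', hP⟩ : G ∣ P := gcd_dvd_left P Q
  obtain ⟨Q', hQ⟩ : G ∣ Q := gcd_dvd_right P Q
  have hcop : IsCoprime P' Q' := by
    have := isCoprime_div_gcd_div_gcd_of_gcd_ne_zero hG0
    rw [← hG] at this
    rwa [hP, hQ, mul_div_cancel_left₀ _ hG0, mul_div_cancel_left₀ _ hG0] at this
  have hred : ∀ φ : ℝ → ℂ, ContDiff ℝ 1 φ →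
      (∀ t : ℝ, P.eval (t : ℂ) * φ t + Q.eval (t : ℂ) * deriv φ t = 0) →
      ∀ t : ℝ, P'.eval (t : ℂ) * φ t + Q'.eval (t : ℂ) * deriv φ t = 0 := by
    intro φ hφ h
    have hdense : Dense {t : ℝ | G.eval (t : ℂ) ≠ 0} := by
      have hfin : Set.Finite {t : ℝ | G.eval (t : ℂ) = 0} := by
        refine ((Polynomial.finite_setOfPred_isRoot hG0).preimage
          (f := ((↑) : ℝ → ℂ)) ofReal_injective.injOn).subset fun t ht => ?_
        simpa [Polynomial.IsRoot] using ht
      exact hfin.countable.dense_compl ℝ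
    have hd : Continuous (deriv φ) := hφ.continuous_deriv le_rfl
    have hc : Continuous φ := hφ.continuous
    have := Continuous.ext_on (f := fun t : ℝ => P'.eval (t : ℂ) * φ t + Q'.eval (t : ℂ) * deriv φ t)
      (g := fun _ => 0) hdense (by fun_prop) continuous_const fun t ht => ?_
    · exact fun t => congrFun this t
    · have h1 := h t
      rw [hP, hQ, Polynomial.eval_mul, Polynomial.eval_mul] at h1
      refine (mul_eq_zero.1 (?_ : G.eval (t : ℂ) * _ = 0)).resolve_left ht
      rw [← h1]
      ring
  by_cases hQ0 : Q'.eval 0 = 0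
  · refine ⟨0, analyticAt_const, fun φ hφ h0 h => ?_⟩
    exfalso
    have h1 := hred φ hφ h 0
    simp only [ofReal_zero, hQ0, h0, mul_one, zero_mul, add_zero] at h1
    obtain ⟨u, v, huv⟩ := hcop
    have := congrArg (Polynomial.eval 0) huv
    simp [hQ0, h1] at this
  · obtain ⟨r, hr, hball⟩ : ∃ r > 0, ∀ z ∈ Metric.ball (0 : ℂ) r, Q'.eval z ≠ 0 := by
      have : ∀ᶠ z in 𝓝 (0 : ℂ), Q'.eval z ≠ 0 := Q'.continuous.continuousAt.eventually_ne hQ0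
      exact Metric.eventually_nhds_iff_ball.1 this
    have hdiff : DifferentiableOn ℂ (fun z => -(P'.eval z / Q'.eval z)) (Metric.ball 0 r) :=
      (P'.differentiable.differentiableOn.div Q'.differentiable.differentiableOn hball).neg
    obtain ⟨g, hg0, hg⟩ := hdiff.isExactOn_ball.with_val_at 0 0
    have hgd : DifferentiableOn ℂ g (Metric.ball 0 r) := fun z hz =>
      (hg z hz).differentiableAt.differentiableWithinAt
    have hga : AnalyticAt ℂ g 0 := hgd.analyticAt (Metric.ball_mem_nhds 0 hr)
    refine ⟨fun t => cexp (g t), ?_, fun φ hφ h0 h => ?_⟩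
    · have h1 : AnalyticAt ℂ (fun z => cexp (g z)) ((0 : ℝ) : ℂ) := by
        rw [ofReal_zero]
        exact hga.cexp
      exact (h1.restrictScalars (𝕜 := ℝ)).comp (ofRealCLM.analyticAt 0)
    · have h' := hred φ hφ h
      have hmem : ∀ t ∈ Metric.ball (0 : ℝ) r, (t : ℂ) ∈ Metric.ball (0 : ℂ) r := by
        intro t ht
        simpa using ht
      have hder : ∀ t ∈ Metric.ball (0 : ℝ) r,
          HasDerivAt (fun t : ℝ => φ t * cexp (-g t)) 0 t := by
        intro t ht
        have hφt : HasDerivAt φ (deriv φ t) t :=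
          (hφ.differentiable (by simp) t).hasDerivAt
        have h1 := hφt.mul ((hg t (hmem t ht)).comp_ofReal.neg.cexp)
        convert! h1 using 1
        have hq := hball t (hmem t ht)
        have h2 : deriv φ t = -(P'.eval (t : ℂ) / Q'.eval (t : ℂ)) * φ t := by
          have := h' t
          field_simp
          linear_combination this
        rw [h2]
        ring
      filter_upwards [Metric.ball_mem_nhds (0 : ℝ) hr] with t ht
      have hconst := Metric.isOpen_ball.is_const_of_deriv_eq_zero
        (convex_ball (0 : ℝ) r).isPreconnected
        (fun x hx => (hder x hx).differentiableAt.differentiableWithinAt)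
        (fun x hx => (hder x hx).deriv) ht (Metric.mem_ball_self hr)
      simp only [ofReal_zero, hg0, h0, neg_zero, Complex.exp_zero, mul_one] at hconst
      rw [Complex.exp_neg] at hconst
      field_simp at hconst
      exact hconst

/-- Iterated derivatives of real parts of complex exponentials. -/
theorem iteratedDeriv_re_const_mul_cexp (c : ℂ) (t : ℝ) (n : ℕ) :
    iteratedDeriv n (fun y : ℝ => (c * cexp (t * y * I)).re) =
      fun y : ℝ => (c * (t * I) ^ n * cexp (t * y * I)).re := by
  induction n with
  | zero => simp
  | succ n ih =>
    rw [iteratedDeriv_succ, ih]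
    funext y
    have h1 : HasDerivAt (fun z : ℂ => (t : ℂ) * z * I) ((t : ℂ) * I) (y : ℂ) := by
      simpa using ((hasDerivAt_id (y : ℂ)).const_mul (t : ℂ)).mul_const I
    have h2 := (h1.cexp.const_mul (c * (t * I) ^ n)).real_of_complex
    rw [h2.deriv]
    ring_nf

theorem memFlin_re_const_mul_cexp {Ω : Type*} [MeasurableSpace Ω] {μ : Measure Ω}
    [IsFiniteMeasure μ] {Y : Ω → ℝ} (hY : Measurable Y) (hYi : Integrable Y μ) (T : ℕ)
    (c : ℂ) (t : ℝ) : memFlin μ Y T (fun y : ℝ => (c * cexp (t * y * I)).re) := by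
  refine ⟨?_, fun k _ j hj => ?_⟩
  · have h : ContDiff ℝ (T : ℕ∞) fun y : ℝ => c * cexp (t * y * I) := by
      have : ContDiff ℝ (T : ℕ∞) fun y : ℝ => (y : ℂ) := ofRealCLM.contDiff
      fun_prop
    exact reCLM.contDiff.comp h
  · rw [iteratedDeriv_re_const_mul_cexp]
    have hYj : Integrable (fun ω => Y ω ^ j) μ := by
      interval_cases j
      · simp
      · simpa using hYi
    refine hYj.mul_bdd (c := ‖c * (t * I) ^ k‖) (by fun_prop) (ae_of_all _ fun ω => ?_)
    refine (abs_re_le_norm _).trans ?_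
    rw [norm_mul, ← ofReal_mul, norm_exp_ofReal_mul_I, mul_one]

/-- The symbol of a differential operator with coefficients `a`, on the imaginary axis. -/
noncomputable def fourierSymbol (T : ℕ) (a : ℕ → ℝ) : Polynomial ℂ :=
  ∑ l ∈ Finset.range (T + 1), Polynomial.C (a l * I ^ l) * Polynomial.X ^ l

theorem fourierSymbol_eval (T : ℕ) (a : ℕ → ℝ) (z : ℂ) :
    (fourierSymbol T a).eval z = ∑ l ∈ Finset.range (T + 1), a l * (z * I) ^ l := by
  simp only [fourierSymbol, Polynomial.eval_finsetSum, Polynomial.eval_mul, Polynomial.eval_C,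
    Polynomial.eval_pow, Polynomial.eval_X]
  exact Finset.sum_congr rfl fun l _ => by ring

theorem fourierSymbol_ne_zero {T : ℕ} {a : ℕ → ℝ} {l : ℕ} (hl : l ≤ T) (ha : a l ≠ 0) :
    fourierSymbol T a ≠ 0 := by
  intro h
  have := congrArg (fun p => Polynomial.coeff p l) h
  simp only [fourierSymbol, Polynomial.finsetSum_coeff, Polynomial.coeff_C_mul_X_pow,
    Polynomial.coeff_zero] at this
  rw [Finset.sum_eq_single_of_mem l (by simp; omega) (fun b _ hb => if_neg hb.symm)] at this
  simp [ha] at this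

/-- The Stein identity for complex exponentials is a differential equation for the characteristic
function. -/
theorem charFun_ode_of_integral_steinLin_eq_zero {Ω : Type*} [MeasurableSpace Ω] {μ : Measure Ω}
    [IsFiniteMeasure μ] {X : Ω → ℝ} (hX : Measurable X) (hXi : Integrable X μ) {T : ℕ}
    {a₀ a₁ : ℕ → ℝ} {t : ℝ}
    (h : ∀ c : ℂ, ∫ ω, steinLin T a₀ a₁ (fun y : ℝ => (c * cexp (t * y * I)).re) (X ω) ∂μ = 0) :
    (fourierSymbol T a₀).eval (t : ℂ) * charFun (μ.map X) t +
      (Polynomial.C (-I) * fourierSymbol T a₁).eval (t : ℂ) * deriv (charFun (μ.map X)) t = 0 := by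
  have hid : MemLp id ((1 : ℕ) : ENNReal) (μ.map X) := by
    rw [Nat.cast_one, memLp_one_iff_integrable]
    exact (integrable_map_measure (by fun_prop) hX.aemeasurable).2 hXi
  have hderiv : deriv (charFun (μ.map X)) t = I * ∫ ω, X ω * cexp (t * X ω * I) ∂μ := by
    rw [← iteratedDeriv_one, iteratedDeriv_charFun hid, integral_map hX.aemeasurable (by fun_prop)]
    simp
  have hchar : charFun (μ.map X) t = ∫ ω, cexp (t * X ω * I) ∂μ := by
    rw [charFun_apply_real, integral_map hX.aemeasurable (by fun_prop)]
  have hbd : ∀ ω, ‖cexp (t * X ω * I)‖ ≤ 1 := fun ω => by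
    rw [← ofReal_mul, norm_exp_ofReal_mul_I]
  have hi0 : Integrable (fun ω => cexp (t * X ω * I)) μ :=
    Integrable.of_bound (by fun_prop) 1 (ae_of_all _ hbd)
  have hi1 : Integrable (fun ω => X ω * cexp (t * X ω * I)) μ :=
    hXi.ofReal.mul_bdd (c := 1) (by fun_prop) (ae_of_all _ hbd)
  set A := (fourierSymbol T a₀).eval (t : ℂ) with hA
  set B := (fourierSymbol T a₁).eval (t : ℂ) with hB
  have hZ : (fourierSymbol T a₀).eval (t : ℂ) * charFun (μ.map X) t +
      (Polynomial.C (-I) * fourierSymbol T a₁).eval (t : ℂ) * deriv (charFun (μ.map X)) t =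
      ∫ ω, (A * cexp (t * X ω * I) + B * (X ω * cexp (t * X ω * I))) ∂μ := by
    rw [integral_add (hi0.const_mul _) (hi1.const_mul _), integral_const_mul, integral_const_mul,
      hderiv, hchar, Polynomial.eval_mul, Polynomial.eval_C, ← hA, ← hB]
    linear_combination (-B * ∫ ω, X ω * cexp (t * X ω * I) ∂μ) * I_mul_I
  rw [hZ]
  have hi : Integrable (fun ω => A * cexp (t * X ω * I) + B * (X ω * cexp (t * X ω * I))) μ :=
    (hi0.const_mul _).add (hi1.const_mul _)
  have hre : ∀ c : ℂ,
      (c * ∫ ω, (A * cexp (t * X ω * I) + B * (X ω * cexp (t * X ω * I))) ∂μ).re = 0 := by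
    intro c
    rw [← integral_const_mul, ← RCLike.re_eq_complex_re, ← integral_re (hi.const_mul c), ← h c]
    refine integral_congr_ae (ae_of_all _ fun ω => ?_)
    simp only [steinLin, iteratedDeriv_re_const_mul_cexp, RCLike.re_eq_complex_re, hA, hB,
      fourierSymbol_eval]
    rw [Finset.sum_mul, Finset.sum_mul, ← Finset.sum_add_distrib, Finset.mul_sum, re_sum]
    refine Finset.sum_congr rfl fun l _ => ?_
    rw [← re_ofReal_mul]
    congr 1
    push_cast
    ring
  refine Complex.ext ?_ ?_
  · simpa using hre 1
  · simpa using hre (-I)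

/-- Every nonzero Stein operator with linear coefficients characterises its target distribution
among the laws of integrable real random variables. -/
theorem stein_linear_coefficients_characterise
    {Ω Ω' : Type*} [MeasurableSpace Ω] [MeasurableSpace Ω']
    (μ : Measure Ω) [IsProbabilityMeasure μ] (ν : Measure Ω') [IsProbabilityMeasure ν]
    (T : ℕ) (a₀ a₁ : ℕ → ℝ)
    (hS : ∃ l ≤ T, a₀ l ≠ 0 ∨ a₁ l ≠ 0)
    (Y : Ω → ℝ) (hY : Measurable Y)
    (hYcont : Measure.map Y μ ≪ volume)
    (hYmom : Integrable (fun ω => |Y ω|) μ)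
    (hSY : ∀ f : ℝ → ℝ, memFlin μ Y T f → ∫ ω, steinLin T a₀ a₁ f (Y ω) ∂μ = 0)
    (W : Ω' → ℝ) (hW : Measurable W)
    (hWmom : Integrable (fun ω => |W ω|) ν)
    (hSW : ∀ f : ℝ → ℝ, memFlin μ Y T f → ∫ ω, steinLin T a₀ a₁ f (W ω) ∂ν = 0) :
    Measure.map W ν = Measure.map Y μ := by
  have hYi : Integrable Y μ := (integrable_norm_iff hY.aestronglyMeasurable).1 hYmom
  have hWi : Integrable W ν := (integrable_norm_iff hW.aestronglyMeasurable).1 hWmom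
  have : IsProbabilityMeasure (μ.map Y) := Measure.isProbabilityMeasure_map hY.aemeasurable
  have : IsProbabilityMeasure (ν.map W) := Measure.isProbabilityMeasure_map hW.aemeasurable
  have hPQ : fourierSymbol T a₀ ≠ 0 ∨ Polynomial.C (-I) * fourierSymbol T a₁ ≠ 0 := by
    obtain ⟨l, hl, h | h⟩ := hS
    · exact Or.inl (fourierSymbol_ne_zero hl h)
    · exact Or.inr (mul_ne_zero (by simp) (fourierSymbol_ne_zero hl h))
  obtain ⟨F, hF, hode⟩ := exists_analyticAt_forall_eventuallyEq_of_linear_ode _ _ hPQ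
  have hsmooth : ∀ m : Measure ℝ, IsFiniteMeasure m → Integrable id m →
      ContDiff ℝ 1 (charFun m) := fun m _ hm => by
    have h1 : MemLp id ((1 : ℕ) : ENNReal) m := by simpa using memLp_one_iff_integrable.2 hm
    simpa using contDiff_charFun h1
  have hYF : charFun (μ.map Y) =ᶠ[𝓝 0] F :=
    hode _ (hsmooth _ inferInstance
      ((integrable_map_measure (by fun_prop) hY.aemeasurable).2 hYi)) (by simp) fun t =>
      charFun_ode_of_integral_steinLin_eq_zero hY hYi fun c =>
        hSY _ (memFlin_re_const_mul_cexp hY hYi T c t)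
  have hWF : charFun (ν.map W) =ᶠ[𝓝 0] F :=
    hode _ (hsmooth _ inferInstance
      ((integrable_map_measure (by fun_prop) hW.aemeasurable).2 hWi)) (by simp) fun t =>
      charFun_ode_of_integral_steinLin_eq_zero hW hWi fun c =>
        hSW _ (memFlin_re_const_mul_cexp hY hYi T c t)
  exact Measure.ext_of_charFun_eventuallyEq
    (zero_mem_interior_integrableExpSet_of_analyticAt_charFun (hF.congr hWF.symm))
    (zero_mem_interior_integrableExpSet_of_analyticAt_charFun (hF.congr hYF.symm))
    (hWF.trans hYF.symm)
end

section
/- Let $r,\lambda,\sigma^2>0$. Let $G_1\sim\Gamma(r,\lambda)$ (density $\lambda^r x^{r-1}e^{-\lambda x}/\Gamma(r)$ on $(0,\infty)$) and $X\sim N(0,\sigma^2)$ be independent, and set $Y=G_1X$. Define the operator $$\mathcal{S}f(y)=y^2f^{(3)}(y)+2(r+1)yf''(y)+r(r+1)f'(y)-\frac{\lambda^2}{\sigma^2}\,y f(y),$$ and let $\mathcal{F}_{\mathcal{S},Y}$ be the set of all three times continuously differentiable functions $f:\mathbb{R}\to\mathbb{R}$ such that $\mathbb{E}|Y^jf^{(t)}(Y)|<\infty$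 for all $t\in\{0,1,2,3\}$ and $j\in\{0,1,2\}$. Let $W$ be a real-valued random variable with $\mathbb{E}[W^2]<\infty$. Then $W$ is equal in law to $G_1X$ if and only if, for all $f\in\mathcal{F}_{\mathcal{S},Y}$, $\mathcal{S}f(W)$ is integrable and $\mathbb{E}[\mathcal{S}f(W)]=0$. -/
open MeasureTheory ProbabilityTheory
open scoped NNReal

/-- The Stein operator
`S f (y) = y² f⁽³⁾(y) + 2(r+1) y f''(y) + r(r+1) f'(y) - (lam²/v) y f(y)`
for the product of independent `Γ(r, lam)` and `N(0, v)` random variables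
(`v` is the variance). -/
noncomputable def steinOpGammaGauss (r lam v : ℝ) (f : ℝ → ℝ) (y : ℝ) : ℝ :=
  y ^ 2 * iteratedDeriv 3 f y + 2 * (r + 1) * y * iteratedDeriv 2 f y
    + r * (r + 1) * iteratedDeriv 1 f y - lam ^ 2 / v * y * f y

/-- The class `F_{S,Y}` for a differential operator `S` of order `T` with polynomial coefficients
of maximal degree `m` and a random variable `Y` whose support is the whole real line:
all `f ∈ C^T(ℝ)` with `E|Y^j f^(t)(Y)| < ∞` for `0 ≤ t ≤ T`, `0 ≤ j ≤ m`. -/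
def steinClass {Ω : Type*} [MeasurableSpace Ω] (T m : ℕ) (P : Measure Ω) (Y : Ω → ℝ) :
    Set (ℝ → ℝ) :=
  {f | ContDiff ℝ T f ∧
    ∀ t ≤ T, ∀ j ≤ m, Integrable (fun ω => Y ω ^ j * iteratedDeriv t f (Y ω)) P}

open Set Filter Topology in
lemma integral_Ioi_eq_zero_of_hasDerivAt {F F' : ℝ → ℝ} (hcont : ContinuousWithinAt F (Ici 0) 0)
    (hF0 : F 0 = 0) (hderiv : ∀ x ∈ Ioi (0 : ℝ), HasDerivAt F (F' x) x)
    (hF' : IntegrableOn F' (Ioi 0)) (hF : IntegrableOn F (Ioi 0)) :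
    ∫ x in Ioi (0 : ℝ), F' x = 0 := by
  rw [integral_Ioi_of_hasDerivAt_of_tendsto hcont hderiv hF'
    (tendsto_zero_of_hasDerivAt_of_integrableOn_Ioi hderiv hF' hF), hF0, sub_zero]

section GammaMeasure

lemma integrableOn_rpow_mul_exp_neg_mul {a lam : ℝ} (ha : -1 < a) (hlam : 0 < lam) :
    IntegrableOn (fun g : ℝ => g ^ a * Real.exp (-(lam * g))) (Set.Ioi 0) := by
  have h := integrableOn_rpow_mul_exp_neg_mul_rpow (p := 1) (s := a) (b := lam) ha one_pos hlam
  simpa using h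

lemma toReal_gammaPDF_eq_indicator {r lam : ℝ} (hr : 0 < r) (hlam : 0 < lam) :
    (fun g => (gammaPDF r lam g).toReal) =ᵐ[volume] (Set.Ioi (0 : ℝ)).indicator
      fun g => lam ^ r / Real.Gamma r * (g ^ (r - 1) * Real.exp (-(lam * g))) := by
  filter_upwards [Measure.ae_ne volume (0 : ℝ)] with g hg0
  rw [gammaPDF, ENNReal.toReal_ofReal (gammaPDFReal_nonneg hr hlam g), gammaPDFReal]
  rcases lt_or_gt_of_ne hg0 with hg | hg
  · rw [if_neg hg.not_ge, Set.indicator_of_notMem (by simpa using hg.le)]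
  · rw [if_pos hg.le, Set.indicator_of_mem (by simpa using hg), mul_assoc]

lemma measurable_gammaPDF (r lam : ℝ) : Measurable (gammaPDF r lam) :=
  (measurable_gammaPDFReal r lam).ennreal_ofReal

lemma integrable_gammaMeasure_iff {r lam : ℝ} (hr : 0 < r) (hlam : 0 < lam) {h : ℝ → ℝ} :
    Integrable h (gammaMeasure r lam) ↔
      IntegrableOn (fun g => g ^ (r - 1) * Real.exp (-(lam * g)) * h g) (Set.Ioi 0) := by
  have hc : lam ^ r / Real.Gamma r ≠ 0 := by positivity
  rw [gammaMeasure, integrable_withDensity_iff_integrable_smul' (measurable_gammaPDF r lam)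
    (ae_of_all _ fun g => ENNReal.ofReal_lt_top), ← integrable_indicator_iff measurableSet_Ioi,
    ← integrable_const_mul_iff (c := lam ^ r / Real.Gamma r) hc.isUnit (Set.indicator _ _)]
  refine integrable_congr ?_
  filter_upwards [toReal_gammaPDF_eq_indicator hr hlam] with g hg
  rw [hg, smul_eq_mul]
  by_cases h0 : g ∈ Set.Ioi (0 : ℝ)
  · simp only [Set.indicator_of_mem h0]; ring
  · simp only [Set.indicator_of_notMem h0]; ring

lemma integral_gammaMeasure {r lam : ℝ} (hr : 0 < r) (hlam : 0 < lam) (h : ℝ → ℝ) :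
    ∫ g, h g ∂gammaMeasure r lam = lam ^ r / Real.Gamma r *
      ∫ g in Set.Ioi (0 : ℝ), g ^ (r - 1) * Real.exp (-(lam * g)) * h g := by
  rw [gammaMeasure, integral_withDensity_eq_integral_toReal_smul (measurable_gammaPDF r lam)
    (ae_of_all _ fun g => ENNReal.ofReal_lt_top), ← integral_indicator measurableSet_Ioi,
    ← integral_const_mul]
  refine integral_congr_ae ?_
  filter_upwards [toReal_gammaPDF_eq_indicator hr hlam] with g hg
  rw [hg, smul_eq_mul]
  by_cases h0 : g ∈ Set.Ioi (0 : ℝ)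
  · simp only [Set.indicator_of_mem h0]; ring
  · simp only [Set.indicator_of_notMem h0]; ring

lemma lintegral_gammaMeasure {r lam : ℝ} (hr : 0 < r) (hlam : 0 < lam) {h : ℝ → ENNReal}
    (hh : Measurable h) :
    ∫⁻ g, h g ∂gammaMeasure r lam = ENNReal.ofReal (lam ^ r / Real.Gamma r) *
      ∫⁻ g in Set.Ioi (0 : ℝ), ENNReal.ofReal (g ^ (r - 1) * Real.exp (-(lam * g))) * h g := by
  have hc : 0 ≤ lam ^ r / Real.Gamma r := by positivity
  rw [gammaMeasure, lintegral_withDensity_eq_lintegral_mul _ (measurable_gammaPDF r lam) hh,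
    ← lintegral_indicator measurableSet_Ioi, ← lintegral_const_mul' _ _ ENNReal.ofReal_ne_top]
  refine lintegral_congr_ae ?_
  filter_upwards [toReal_gammaPDF_eq_indicator hr hlam] with g hg
  have hg' : gammaPDF r lam g = ENNReal.ofReal (gammaPDF r lam g).toReal :=
    (ENNReal.ofReal_toReal ENNReal.ofReal_ne_top).symm
  rw [Pi.mul_apply, hg', hg]
  by_cases h0 : g ∈ Set.Ioi (0 : ℝ)
  · simp only [Set.indicator_of_mem h0, ENNReal.ofReal_mul hc, mul_assoc]
  · simp only [Set.indicator_of_notMem h0, ENNReal.ofReal_zero, zero_mul, mul_zero]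

lemma integrable_pow_gammaMeasure {r lam : ℝ} (hr : 0 < r) (hlam : 0 < lam) (n : ℕ) :
    Integrable (fun g => g ^ n) (gammaMeasure r lam) := by
  rw [integrable_gammaMeasure_iff hr hlam]
  refine (integrableOn_rpow_mul_exp_neg_mul (a := r - 1 + n) (by
    have : (0 : ℝ) ≤ n := n.cast_nonneg
    linarith) hlam).congr_fun (fun g (hg : 0 < g) => ?_) measurableSet_Ioi
  simp only [Real.rpow_add_natCast hg.ne']
  ring

/-- The second order Stein identity of the gamma distribution. -/
lemma integral_gammaMeasure_stein {r lam : ℝ} (hr : 0 < r) (hlam : 0 < lam) {h h₁ h₂ : ℝ → ℝ}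
    (hh : ∀ g, HasDerivAt h (h₁ g) g) (hh₁ : ∀ g, HasDerivAt h₁ (h₂ g) g)
    (i0 : Integrable h (gammaMeasure r lam))
    (i1 : Integrable (fun g => g * h g) (gammaMeasure r lam))
    (i2 : Integrable (fun g => g ^ 2 * h g) (gammaMeasure r lam))
    (j1 : Integrable (fun g => g * h₁ g) (gammaMeasure r lam))
    (j2 : Integrable (fun g => g ^ 2 * h₁ g) (gammaMeasure r lam))
    (k2 : Integrable (fun g => g ^ 2 * h₂ g) (gammaMeasure r lam)) :
    ∫ g, (g ^ 2 * h₂ g + 2 * (r + 1) * (g * h₁ g) + r * (r + 1) * h g) ∂gammaMeasure r lam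
      = ∫ g, lam ^ 2 * (g ^ 2 * h g) ∂gammaMeasure r lam := by
  have iL : Integrable (fun g => g ^ 2 * h₂ g + 2 * (r + 1) * (g * h₁ g) + r * (r + 1) * h g)
      (gammaMeasure r lam) := (k2.add (j1.const_mul _)).add (i0.const_mul _)
  have iR := i2.const_mul (lam ^ 2)
  have iD := iL.sub iR
  rw [← sub_eq_zero, ← integral_sub iL iR, integral_gammaMeasure hr hlam]
  have iU := (j2.add (i1.const_mul (r + 1))).add (i2.const_mul lam)
  rw [integrable_gammaMeasure_iff hr hlam] at iD iU
  have hc : Continuous h := continuous_iff_continuousAt.2 fun g => (hh g).continuousAt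
  have hc₁ : Continuous h₁ := continuous_iff_continuousAt.2 fun g => (hh₁ g).continuousAt
  have hp1 : Continuous fun g : ℝ => g ^ (r + 1) := Real.continuous_rpow_const (by linarith)
  have hp0 : Continuous fun g : ℝ => g ^ r := Real.continuous_rpow_const hr.le
  have e1 : ∀ g : ℝ, 0 < g → g ^ (r + 1) = g ^ (r - 1) * g ^ 2 := fun g hg => by
    rw [← Real.rpow_natCast, ← Real.rpow_add hg]; congr 1; push_cast; ring
  have e0 : ∀ g : ℝ, 0 < g → g ^ r = g ^ (r - 1) * g := fun g hg => by
    rw [← Real.rpow_add_one hg.ne']; congr 1; ring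
  rw [integral_Ioi_eq_zero_of_hasDerivAt
    (F := fun g => Real.exp (-(lam * g)) *
      (g ^ (r + 1) * h₁ g + (r + 1) * (g ^ r * h g) + lam * (g ^ (r + 1) * h g))), mul_zero]
  · exact Continuous.continuousWithinAt (by fun_prop)
  · simp [Real.zero_rpow hr.ne', Real.zero_rpow (by linarith : r + 1 ≠ 0)]
  · intro g hg
    have hg : 0 < g := hg
    have d1 : HasDerivAt (fun g : ℝ => g ^ (r + 1)) ((r + 1) * g ^ r) g := by
      simpa using Real.hasDerivAt_rpow_const (x := g) (p := r + 1) (Or.inl hg.ne')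
    have d0 : HasDerivAt (fun g : ℝ => g ^ r) (r * g ^ (r - 1)) g :=
      Real.hasDerivAt_rpow_const (Or.inl hg.ne')
    have dE : HasDerivAt (fun g : ℝ => Real.exp (-(lam * g)))
        (Real.exp (-(lam * g)) * (-(lam * 1))) g := ((hasDerivAt_id g).const_mul lam).neg.exp
    refine (dE.mul (((d1.mul (hh₁ g)).add ((d0.mul (hh g)).const_mul (r + 1))).add
      ((d1.mul (hh g)).const_mul lam))).congr_deriv ?_
    simp only [Pi.add_apply, Pi.mul_apply, e1 g hg, e0 g hg]
    ring
  · exact iD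
  · refine iU.congr_fun (fun g (hg : 0 < g) => ?_) measurableSet_Ioi
    simp only [e1 g hg, e0 g hg, Pi.add_apply]
    ring

end GammaMeasure

/-- Stein's identity for the centred Gaussian distribution. -/
lemma integral_gaussianReal_stein {v : ℝ≥0} (hv : v ≠ 0) {k k' : ℝ → ℝ}
    (hk : ∀ x, HasDerivAt k (k' x) x) (i0 : Integrable k (gaussianReal 0 v))
    (i1 : Integrable (fun x => x * k x) (gaussianReal 0 v))
    (j0 : Integrable k' (gaussianReal 0 v)) :
    ∫ x, x * k x ∂gaussianReal 0 v = v * ∫ x, k' x ∂gaussianReal 0 v := by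
  have hv0 : (v : ℝ) ≠ 0 := by exact_mod_cast hv
  have key : ∀ {f : ℝ → ℝ}, Integrable f (gaussianReal 0 v) →
      Integrable (fun x => gaussianPDFReal 0 v x * f x) := fun {f} hf => by
    rw [gaussianReal_of_var_ne_zero 0 hv, integrable_withDensity_iff_integrable_smul'
      (measurable_gaussianPDF 0 v) (ae_of_all _ fun _ => gaussianPDF_lt_top)] at hf
    simpa only [toReal_gaussianPDF, smul_eq_mul] using hf
  have iD := (j0.const_mul (v : ℝ)).sub i1
  rw [← integral_const_mul, eq_comm, ← sub_eq_zero, ← integral_sub (j0.const_mul _) i1,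
    integral_gaussianReal_eq_integral_smul hv]
  refine integral_eq_zero_of_hasDerivAt_of_integrable
    (f := fun x => v * (gaussianPDFReal 0 v x * k x)) (fun x => ?_) (key iD)
    ((key i0).const_mul _)
  have dE : HasDerivAt (gaussianPDFReal 0 v)
      ((√(2 * Real.pi * v))⁻¹ * (Real.exp (-(x - 0) ^ 2 / (2 * v)) *
        (-(((2 : ℕ) : ℝ) * (x - 0) ^ (2 - 1) * 1) / (2 * v)))) x :=
    ((((hasDerivAt_id x).sub_const 0).pow 2).neg.div_const (2 * (v : ℝ))).exp.const_mul _
  refine ((dE.mul (hk x)).const_mul (v : ℝ)).congr_deriv ?_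
  rw [smul_eq_mul, gaussianPDFReal]
  field_simp
  push_cast
  ring

section ConditionalMoment

open Set Filter Topology

lemma rpow_le_mul_rpow_add_one_add {g ε : ℝ} (hg : 0 < g) (hε : 0 < ε) (r : ℝ) :
    g ^ r ≤ ε * g ^ (r + 1) + (ε ^ 2)⁻¹ * g ^ (r - 2) := by
  have h1 : g ^ (r + 1) = g ^ r * g := Real.rpow_add_one hg.ne' r
  have h2 : g ^ r = g ^ (r - 2) * g ^ 2 := by
    rw [← Real.rpow_natCast, ← Real.rpow_add hg]; congr 1; push_cast; ring
  have p0 : 0 < g ^ r := Real.rpow_pos_of_pos hg _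
  have p2 : 0 < g ^ (r - 2) := Real.rpow_pos_of_pos hg _
  rcases le_total 1 (ε * g) with h | h
  · have : g ^ r * 1 ≤ g ^ r * (ε * g) := by gcongr
    have : 0 ≤ (ε ^ 2)⁻¹ * g ^ (r - 2) := by positivity
    rw [h1]; linarith
  · have h3 : g ^ 2 ≤ (ε ^ 2)⁻¹ := by
      rw [le_inv_comm₀ (by positivity) (by positivity), ← one_div,
        le_div_iff₀ (by positivity), ← mul_pow]
      exact pow_le_one₀ (by positivity) h
    have : g ^ (r - 2) * g ^ 2 ≤ g ^ (r - 2) * (ε ^ 2)⁻¹ := by gcongr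
    have : 0 ≤ ε * g ^ (r + 1) := by positivity
    linarith

lemma integrableOn_rpow_mul_exp_sub {a lam s : ℝ} (ha : -1 < a) (hlam : 0 < lam) (hs : 0 ≤ s) :
    IntegrableOn (fun g : ℝ => g ^ a * Real.exp (-(lam * g) - s / g ^ 2)) (Ioi 0) := by
  refine Integrable.mono' (integrableOn_rpow_mul_exp_neg_mul ha hlam)
    (Measurable.aestronglyMeasurable (by fun_prop)) ?_
  filter_upwards [ae_restrict_mem measurableSet_Ioi] with g hg
  have hg : 0 < g := hg
  have : 0 ≤ s / g ^ 2 := by positivity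
  rw [Real.norm_of_nonneg (by positivity)]
  gcongr
  linarith

lemma integral_rpow_mul_exp_le {r lam s : ℝ} (hr : 0 < r) (hlam : 0 < lam) (hs : 0 ≤ s)
    (hint : IntegrableOn (fun g : ℝ => g ^ (r - 2) * Real.exp (-(lam * g) - s / g ^ 2)) (Ioi 0)) :
    lam / 2 * ∫ g in Ioi (0 : ℝ), g ^ (r + 1) * Real.exp (-(lam * g) - s / g ^ 2) ≤
      ((r + 1) * ((lam / (2 * (r + 1))) ^ 2)⁻¹ + 2 * s) *
        ∫ g in Ioi (0 : ℝ), g ^ (r - 2) * Real.exp (-(lam * g) - s / g ^ 2) := by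
  have hexp : ∀ g : ℝ, Real.exp (-(lam * g) - s / g ^ 2) ≤ Real.exp (-(lam * g)) := fun g => by
    have : 0 ≤ s / g ^ 2 := by positivity
    gcongr; linarith
  have i1 := integrableOn_rpow_mul_exp_sub (a := r + 1) (by linarith) hlam hs
  have i0 := integrableOn_rpow_mul_exp_sub (a := r) (by linarith) hlam hs
  have hzero := integral_Ioi_eq_zero_of_hasDerivAt
    (F := fun g => g ^ (r + 1) * Real.exp (-(lam * g) - s / g ^ 2))
    (F' := fun g => (r + 1) * (g ^ r * Real.exp (-(lam * g) - s / g ^ 2))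
      - lam * (g ^ (r + 1) * Real.exp (-(lam * g) - s / g ^ 2))
      + 2 * s * (g ^ (r - 2) * Real.exp (-(lam * g) - s / g ^ 2))) ?_
    (by simp [Real.zero_rpow (by linarith : r + 1 ≠ 0)]) ?_
    (((i0.const_mul _).sub (i1.const_mul _)).add (hint.const_mul _)) i1
  · rw [integral_add (by exact (i0.const_mul _).sub (i1.const_mul _)) (hint.const_mul _),
      integral_sub (i0.const_mul _) (i1.const_mul _), integral_const_mul, integral_const_mul,
      integral_const_mul] at hzero
    have hle : ∫ g in Ioi (0 : ℝ), g ^ r * Real.exp (-(lam * g) - s / g ^ 2) ≤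
        lam / (2 * (r + 1)) * (∫ g in Ioi (0 : ℝ), g ^ (r + 1) * Real.exp (-(lam * g) - s / g ^ 2))
        + ((lam / (2 * (r + 1))) ^ 2)⁻¹ *
          ∫ g in Ioi (0 : ℝ), g ^ (r - 2) * Real.exp (-(lam * g) - s / g ^ 2) := by
      rw [← integral_const_mul, ← integral_const_mul, ← integral_add (i1.const_mul _)
        (hint.const_mul _)]
      refine setIntegral_mono_on i0 ((i1.const_mul _).add (hint.const_mul _)) measurableSet_Ioi
        fun g hg => ?_
      have := mul_le_mul_of_nonneg_right (rpow_le_mul_rpow_add_one_add (g := g)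
        (ε := lam / (2 * (r + 1))) hg (by positivity) r)
        (Real.exp_pos (-(lam * g) - s / g ^ 2)).le
      linarith
    have h2 := mul_le_mul_of_nonneg_left hle (by linarith : 0 ≤ r + 1)
    have h3 : (r + 1) * (lam / (2 * (r + 1))) = lam / 2 := by field_simp
    rw [mul_add, ← mul_assoc, h3, ← mul_assoc] at h2
    linarith
  · have hF0 : (0 : ℝ) ^ (r + 1) * Real.exp (-(lam * 0) - s / 0 ^ 2) = 0 := by
      simp [Real.zero_rpow (by linarith : r + 1 ≠ 0)]
    rw [ContinuousWithinAt, hF0]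
    have hb : Tendsto (fun g : ℝ => g ^ (r + 1)) (𝓝[Ici 0] 0) (𝓝 0) := by
      have := (Real.continuous_rpow_const (q := r + 1) (by linarith)).continuousWithinAt
        (s := Ici 0) (x := 0)
      simpa [ContinuousWithinAt, Real.zero_rpow (by linarith : r + 1 ≠ 0)] using this
    refine tendsto_of_tendsto_of_tendsto_of_le_of_le' tendsto_const_nhds hb ?_ ?_
    · filter_upwards [self_mem_nhdsWithin] with g (hg : 0 ≤ g)
      positivity
    · filter_upwards [self_mem_nhdsWithin] with g (hg : 0 ≤ g)
      refine mul_le_of_le_one_right (by positivity) ((hexp g).trans ?_)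
      exact Real.exp_le_one_iff.2 (by nlinarith)
  · intro g hg
    have hg : 0 < g := hg
    have d1 : HasDerivAt (fun g : ℝ => g ^ (r + 1)) ((r + 1) * g ^ r) g := by
      simpa using Real.hasDerivAt_rpow_const (x := g) (p := r + 1) (Or.inl hg.ne')
    have dq := (hasDerivAt_const g s).div ((hasDerivAt_id g).pow 2)
      (pow_ne_zero 2 hg.ne')
    have dE := ((((hasDerivAt_id g).const_mul lam).neg.sub dq)).exp
    refine (d1.mul dE).congr_deriv ?_
    have e1 : g ^ (r + 1) = g ^ (r - 2) * g ^ 3 := by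
      rw [← Real.rpow_natCast, ← Real.rpow_add hg]; congr 1; push_cast; ring
    simp only [Pi.sub_apply, Pi.neg_apply, Pi.div_apply, Pi.pow_apply, id, e1]
    field_simp
    push_cast
    ring

lemma lintegral_rpow_mul_exp_le {r lam : ℝ} (hr : 0 < r) (hlam : 0 < lam) :
    ∃ C : ℝ, 0 < C ∧ ∀ s : ℝ, 0 ≤ s →
      ∫⁻ g in Ioi (0 : ℝ), ENNReal.ofReal (g ^ (r + 1) * Real.exp (-(lam * g) - s / g ^ 2)) ≤
      ENNReal.ofReal (C * (1 + s)) *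
        ∫⁻ g in Ioi (0 : ℝ), ENNReal.ofReal (g ^ (r - 2) * Real.exp (-(lam * g) - s / g ^ 2)) := by
  set A : ℝ := (r + 1) * ((lam / (2 * (r + 1))) ^ 2)⁻¹ with hA
  have hA0 : 0 < A := by positivity
  refine ⟨2 / lam * (A + 2), by positivity, fun s hs => ?_⟩
  have hmeas : ∀ a : ℝ, Measurable fun g : ℝ => g ^ a * Real.exp (-(lam * g) - s / g ^ 2) :=
    fun a => by fun_prop
  have hnn : ∀ a : ℝ, 0 ≤ᵐ[volume.restrict (Ioi (0 : ℝ))]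
      fun g : ℝ => g ^ a * Real.exp (-(lam * g) - s / g ^ 2) := fun a => by
    filter_upwards [ae_restrict_mem measurableSet_Ioi] with g (hg : 0 < g)
    simp only [Pi.zero_apply]
    positivity
  by_cases hint :
      IntegrableOn (fun g : ℝ => g ^ (r - 2) * Real.exp (-(lam * g) - s / g ^ 2)) (Ioi 0)
  · have key := integral_rpow_mul_exp_le hr hlam hs hint
    rw [← hA] at key
    have i1 := integrableOn_rpow_mul_exp_sub (a := r + 1) (by linarith) hlam hs
    rw [← ofReal_integral_eq_lintegral_ofReal i1 (hnn _),
      ← ofReal_integral_eq_lintegral_ofReal hint (hnn _), ← ENNReal.ofReal_mul (by positivity)]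
    refine ENNReal.ofReal_le_ofReal ?_
    have hI : 0 ≤ ∫ g in Ioi (0 : ℝ), g ^ (r - 2) * Real.exp (-(lam * g) - s / g ^ 2) :=
      integral_nonneg_of_ae (hnn _)
    have h2 := key.trans (mul_le_mul_of_nonneg_right
      (by nlinarith : A + 2 * s ≤ (A + 2) * (1 + s)) hI)
    have h3 := mul_le_mul_of_nonneg_left h2 (by positivity : 0 ≤ 2 / lam)
    rw [← mul_assoc, show 2 / lam * (lam / 2) = 1 by field_simp, one_mul] at h3
    linarith
  · have htop : ∫⁻ g in Ioi (0 : ℝ),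
        ENNReal.ofReal (g ^ (r - 2) * Real.exp (-(lam * g) - s / g ^ 2)) = ⊤ := by
      by_contra hne
      exact hint ((lintegral_ofReal_ne_top_iff_integrable (hmeas _).aestronglyMeasurable
        (hnn _)).1 hne)
    rw [htop, ENNReal.mul_top (by simpa using by positivity)]
    exact le_top

end ConditionalMoment

section ProductLaw

lemma lintegral_gaussianReal_comp_const_mul {v : ℝ≥0} (hv : 0 < v) {g : ℝ} (hg : 0 < g)
    {φ : ℝ → ENNReal} (hφ : Measurable φ) :
    ∫⁻ x, φ (g * x) ∂gaussianReal 0 v = ENNReal.ofReal (√(2 * Real.pi * v))⁻¹ *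
      ∫⁻ y, ENNReal.ofReal (g⁻¹ * Real.exp (-(y ^ 2 / (2 * v) / g ^ 2))) * φ y := by
  have hv' : NNReal.mk (g ^ 2) (sq_nonneg g) * v ≠ 0 := by
    refine mul_ne_zero ?_ hv.ne'
    rw [Ne, ← NNReal.coe_eq_zero]
    exact (pow_pos hg 2).ne'
  have hmap := lintegral_map (μ := gaussianReal 0 v) (g := fun x => g * x) hφ (by fun_prop)
  rw [gaussianReal_map_const_mul, mul_zero, gaussianReal_of_var_ne_zero 0 hv',
    lintegral_withDensity_eq_lintegral_mul _ (measurable_gaussianPDF _ _) hφ] at hmap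
  rw [← hmap, ← lintegral_const_mul' _ _ ENNReal.ofReal_ne_top]
  refine lintegral_congr fun y => ?_
  rw [Pi.mul_apply, ← mul_assoc, ← ENNReal.ofReal_mul (by positivity), gaussianPDF,
    gaussianPDFReal]
  congr 2
  have h1 : (2 * Real.pi * ((NNReal.mk (g ^ 2) (sq_nonneg g) * v : ℝ≥0) : ℝ)) =
      g ^ 2 * (2 * Real.pi * v) := by
    rw [NNReal.coe_mul, NNReal.coe_mk]; ring
  rw [h1, Real.sqrt_mul (sq_nonneg g), Real.sqrt_sq hg.le, mul_inv, NNReal.coe_mul, NNReal.coe_mk,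
    mul_comm g⁻¹, mul_assoc]
  congr 3
  have : (0 : ℝ) < v := hv
  field_simp
  ring

lemma lintegral_gamma_gaussian {r lam : ℝ} {v : ℝ≥0} (hr : 0 < r) (hlam : 0 < lam) (hv : 0 < v)
    {ψ : ℝ → ℝ → ENNReal} (hψ : Measurable (Function.uncurry ψ)) :
    ∫⁻ z, ψ z.1 (z.1 * z.2) ∂(gammaMeasure r lam).prod (gaussianReal 0 v) =
      ENNReal.ofReal (lam ^ r / Real.Gamma r) * (ENNReal.ofReal (√(2 * Real.pi * v))⁻¹ *
        ∫⁻ y, ∫⁻ g in Set.Ioi (0 : ℝ),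
          ENNReal.ofReal (g ^ (r - 2) * Real.exp (-(lam * g) - y ^ 2 / (2 * v) / g ^ 2)) *
            ψ g y) := by
  have hm : Measurable fun z : ℝ × ℝ => ψ z.1 (z.1 * z.2) :=
    hψ.comp (by fun_prop : Measurable fun z : ℝ × ℝ => (z.1, z.1 * z.2))
  have := isProbabilityMeasure_gammaMeasure hr hlam
  rw [lintegral_prod _ hm.aemeasurable, lintegral_gammaMeasure hr hlam hm.lintegral_prod_right',
    ← lintegral_const_mul' _ _ ENNReal.ofReal_ne_top, lintegral_lintegral_swap]
  · rw [← lintegral_const_mul' _ _ ENNReal.ofReal_ne_top,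
      ← lintegral_const_mul' _ _ ENNReal.ofReal_ne_top]
    refine setLIntegral_congr_fun measurableSet_Ioi fun g hg => ?_
    have hg : 0 < g := hg
    have hψg : Measurable (ψ g) := hψ.comp measurable_prodMk_left
    simp only
    rw [lintegral_gaussianReal_comp_const_mul hv hg hψg, mul_left_comm (ENNReal.ofReal (_ * _)),
      ← lintegral_const_mul' (ENNReal.ofReal (_ * _)) _ ENNReal.ofReal_ne_top]
    congr 2
    refine lintegral_congr fun y => ?_
    rw [← mul_assoc, ← ENNReal.ofReal_mul (by positivity)]
    congr 2
    have e : g ^ (r - 1) = g ^ (r - 2) * g := by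
      rw [← Real.rpow_add_one hg.ne']; congr 1; ring
    rw [e, sub_eq_add_neg (-(lam * g)), Real.exp_add]
    field_simp
  · refine Measurable.aemeasurable ?_
    refine Measurable.mul (by fun_prop) ?_
    exact hψ.comp measurable_swap

/-- The conditional third moment of `G` given `Y = G X` grows at most quadratically in `Y`. -/
lemma lintegral_gamma_gaussian_cube_le {r lam : ℝ} {v : ℝ≥0} (hr : 0 < r) (hlam : 0 < lam)
    (hv : 0 < v) : ∃ C : ℝ, 0 < C ∧ ∀ φ : ℝ → ENNReal, Measurable φ →
      ∫⁻ z, ‖z.1 ^ 3‖ₑ * φ (z.1 * z.2)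
        ∂(gammaMeasure r lam).prod (gaussianReal 0 v) ≤
      ENNReal.ofReal C * ∫⁻ z, ‖1 + (z.1 * z.2) ^ 2‖ₑ * φ (z.1 * z.2)
        ∂(gammaMeasure r lam).prod (gaussianReal 0 v) := by
  obtain ⟨C, hC, hle⟩ := lintegral_rpow_mul_exp_le hr hlam
  have hv0 : (0 : ℝ) < v := hv
  refine ⟨C * (1 + (2 * (v : ℝ))⁻¹), by positivity, fun φ hφ => ?_⟩
  rw [lintegral_gamma_gaussian hr hlam hv (ψ := fun g y => ‖g ^ 3‖ₑ * φ y)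
      (by unfold Function.uncurry; fun_prop),
    lintegral_gamma_gaussian hr hlam hv (ψ := fun _ y => ‖1 + y ^ 2‖ₑ * φ y)
      (by unfold Function.uncurry; fun_prop),
    mul_left_comm (ENNReal.ofReal (_ * _)), mul_left_comm (ENNReal.ofReal (_ * _)),
    ← lintegral_const_mul' (ENNReal.ofReal (C * _)) _ ENNReal.ofReal_ne_top]
  refine mul_le_mul' le_rfl (mul_le_mul' le_rfl (lintegral_mono fun y => ?_))
  simp only
  have hs : 0 ≤ y ^ 2 / (2 * (v : ℝ)) := by positivity
  have hm : ∀ a : ℝ, Measurable fun g : ℝ =>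
      ENNReal.ofReal (g ^ a * Real.exp (-(lam * g) - y ^ 2 / (2 * v) / g ^ 2)) :=
    fun a => by fun_prop
  have hL : ∫⁻ g in Set.Ioi (0 : ℝ),
      ENNReal.ofReal (g ^ (r - 2) * Real.exp (-(lam * g) - y ^ 2 / (2 * v) / g ^ 2)) *
        (‖g ^ 3‖ₑ * φ y) = (∫⁻ g in Set.Ioi (0 : ℝ),
      ENNReal.ofReal (g ^ (r + 1) * Real.exp (-(lam * g) - y ^ 2 / (2 * v) / g ^ 2))) * φ y := by
    rw [← lintegral_mul_const _ (hm _)]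
    refine setLIntegral_congr_fun measurableSet_Ioi fun g hg => ?_
    have hg : 0 < g := hg
    rw [Real.enorm_of_nonneg (by positivity), ← mul_assoc, ← ENNReal.ofReal_mul (by positivity)]
    congr 2
    have e : g ^ (r + 1) = g ^ (r - 2) * g ^ 3 := by
      rw [← Real.rpow_natCast, ← Real.rpow_add hg]; congr 1; push_cast; ring
    rw [e]; ring
  rw [hL, lintegral_mul_const _ (hm _)]
  calc _ ≤ ENNReal.ofReal (C * (1 + y ^ 2 / (2 * v))) * (∫⁻ g in Set.Ioi (0 : ℝ),
      ENNReal.ofReal (g ^ (r - 2) * Real.exp (-(lam * g) - y ^ 2 / (2 * v) / g ^ 2))) * φ y := by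
        gcongr
        exact hle _ hs
    _ ≤ ENNReal.ofReal (C * (1 + (2 * (v : ℝ))⁻¹) * (1 + y ^ 2)) * (∫⁻ g in Set.Ioi (0 : ℝ),
      ENNReal.ofReal (g ^ (r - 2) * Real.exp (-(lam * g) - y ^ 2 / (2 * v) / g ^ 2))) * φ y := by
        refine mul_le_mul' (mul_le_mul' (ENNReal.ofReal_le_ofReal ?_) le_rfl) le_rfl
        rw [mul_assoc]
        refine mul_le_mul_of_nonneg_left ?_ hC.le
        have : 0 ≤ (2 * (v : ℝ))⁻¹ := by positivity
        rw [div_eq_mul_inv]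
        nlinarith [sq_nonneg y]
    _ = _ := by
        rw [ENNReal.ofReal_mul (by positivity), Real.enorm_of_nonneg (by positivity : 0 ≤ 1 + y ^ 2)]
        ring

lemma integrable_gamma_gaussian_cube {r lam : ℝ} {v : ℝ≥0} (hr : 0 < r) (hlam : 0 < lam)
    (hv : 0 < v) {φ : ℝ → ℝ} (hφ : Measurable φ)
    (i0 : Integrable (fun z : ℝ × ℝ => φ (z.1 * z.2))
      ((gammaMeasure r lam).prod (gaussianReal 0 v)))
    (i2 : Integrable (fun z : ℝ × ℝ => (z.1 * z.2) ^ 2 * φ (z.1 * z.2))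
      ((gammaMeasure r lam).prod (gaussianReal 0 v))) :
    Integrable (fun z : ℝ × ℝ => z.1 ^ 3 * φ (z.1 * z.2))
      ((gammaMeasure r lam).prod (gaussianReal 0 v)) := by
  obtain ⟨C, -, hle⟩ := lintegral_gamma_gaussian_cube_le hr hlam hv
  refine ⟨Measurable.aestronglyMeasurable (by fun_prop), ?_⟩
  have h := (i0.add i2).2
  simp only [HasFiniteIntegral, Pi.add_apply] at h ⊢
  refine lt_of_le_of_lt (le_of_eq_of_le ?_ (hle (fun y => ‖φ y‖ₑ) (by fun_prop)))
    (ENNReal.mul_lt_top ENNReal.ofReal_lt_top (lt_of_eq_of_lt ?_ h))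
  · simp only [enorm_mul]
  · refine lintegral_congr fun z => ?_
    rw [← enorm_mul, add_mul, one_mul]

section Forward

variable {r lam : ℝ} {v : ℝ≥0} {φ : ℝ → ℝ}

lemma integrable_gamma_gaussian_pow_mul (hr : 0 < r) (hlam : 0 < lam)
    (hv : 0 < v) (hφ : Measurable φ)
    (i0 : Integrable (fun z : ℝ × ℝ => φ (z.1 * z.2))
      ((gammaMeasure r lam).prod (gaussianReal 0 v)))
    (i2 : Integrable (fun z : ℝ × ℝ => (z.1 * z.2) ^ 2 * φ (z.1 * z.2))
      ((gammaMeasure r lam).prod (gaussianReal 0 v))) {n : ℕ} (hn : n ≤ 3) :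
    Integrable (fun z : ℝ × ℝ => z.1 ^ n * φ (z.1 * z.2))
      ((gammaMeasure r lam).prod (gaussianReal 0 v)) := by
  have i3 := integrable_gamma_gaussian_cube hr hlam hv hφ i0 i2
  refine Integrable.mono' (i0.norm.add i3.norm)
    (Measurable.aestronglyMeasurable (by fun_prop)) (ae_of_all _ fun z => ?_)
  simp only [Pi.add_apply, norm_mul, norm_pow]
  have h : ‖z.1‖ ^ n ≤ 1 + ‖z.1‖ ^ 3 := by
    rcases le_total ‖z.1‖ 1 with h1 | h1
    · exact (pow_le_one₀ (norm_nonneg _) h1).trans (le_add_of_nonneg_right (by positivity))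
    · exact (pow_le_pow_right₀ h1 hn).trans (le_add_of_nonneg_left zero_le_one)
  nlinarith [mul_le_mul_of_nonneg_right h (norm_nonneg (φ (z.1 * z.2)))]

lemma integrable_gamma_gaussian_mul_mul (hr : 0 < r) (hlam : 0 < lam)
    (hv : 0 < v) (hφ : Measurable φ)
    (i0 : Integrable (fun z : ℝ × ℝ => φ (z.1 * z.2))
      ((gammaMeasure r lam).prod (gaussianReal 0 v)))
    (i2 : Integrable (fun z : ℝ × ℝ => (z.1 * z.2) ^ 2 * φ (z.1 * z.2))
      ((gammaMeasure r lam).prod (gaussianReal 0 v))) :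
    Integrable (fun z : ℝ × ℝ => z.1 * ((z.1 * z.2) * φ (z.1 * z.2)))
      ((gammaMeasure r lam).prod (gaussianReal 0 v)) := by
  have i3 := integrable_gamma_gaussian_cube hr hlam hv hφ i0 i2
  refine Integrable.mono' ((i0.norm.add i2.norm).add i3.norm)
    (Measurable.aestronglyMeasurable (by fun_prop)) (ae_of_all _ fun z => ?_)
  simp only [Pi.add_apply]
  generalize z.1 * z.2 = y
  simp only [norm_mul, norm_pow]
  have ha := norm_nonneg z.1
  have h : ‖z.1‖ * ‖y‖ ≤ 1 + ‖y‖ ^ 2 + ‖z.1‖ ^ 3 := by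
    nlinarith [mul_nonneg (sq_nonneg (‖z.1‖ - 1)) (by linarith : 0 ≤ ‖z.1‖ + 1),
      sq_nonneg (‖z.1‖ - ‖y‖), sq_nonneg ‖y‖, sq_nonneg ‖z.1‖]
  nlinarith [mul_le_mul_of_nonneg_right h (norm_nonneg (φ y))]

/-- The Stein identity of the product of independent gamma and centred Gaussian variables. -/
lemma integral_gamma_gaussian_stein (hr : 0 < r) (hlam : 0 < lam) (hv : 0 < v)
    {f f₁ f₂ f₃ : ℝ → ℝ} (d0 : ∀ y, HasDerivAt f (f₁ y) y) (d1 : ∀ y, HasDerivAt f₁ (f₂ y) y)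
    (d2 : ∀ y, HasDerivAt f₂ (f₃ y) y)
    (i00 : Integrable (fun z : ℝ × ℝ => f (z.1 * z.2))
      ((gammaMeasure r lam).prod (gaussianReal 0 v)))
    (i01 : Integrable (fun z : ℝ × ℝ => (z.1 * z.2) * f (z.1 * z.2))
      ((gammaMeasure r lam).prod (gaussianReal 0 v)))
    (i10 : Integrable (fun z : ℝ × ℝ => f₁ (z.1 * z.2))
      ((gammaMeasure r lam).prod (gaussianReal 0 v)))
    (i12 : Integrable (fun z : ℝ × ℝ => (z.1 * z.2) ^ 2 * f₁ (z.1 * z.2))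
      ((gammaMeasure r lam).prod (gaussianReal 0 v)))
    (i20 : Integrable (fun z : ℝ × ℝ => f₂ (z.1 * z.2))
      ((gammaMeasure r lam).prod (gaussianReal 0 v)))
    (i21 : Integrable (fun z : ℝ × ℝ => (z.1 * z.2) * f₂ (z.1 * z.2))
      ((gammaMeasure r lam).prod (gaussianReal 0 v)))
    (i22 : Integrable (fun z : ℝ × ℝ => (z.1 * z.2) ^ 2 * f₂ (z.1 * z.2))
      ((gammaMeasure r lam).prod (gaussianReal 0 v)))
    (i32 : Integrable (fun z : ℝ × ℝ => (z.1 * z.2) ^ 2 * f₃ (z.1 * z.2))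
      ((gammaMeasure r lam).prod (gaussianReal 0 v))) :
    ∫ z, ((z.1 * z.2) ^ 2 * f₃ (z.1 * z.2) + 2 * (r + 1) * ((z.1 * z.2) * f₂ (z.1 * z.2))
      + r * (r + 1) * f₁ (z.1 * z.2)) ∂(gammaMeasure r lam).prod (gaussianReal 0 v) =
    lam ^ 2 / v * ∫ z, (z.1 * z.2) * f (z.1 * z.2)
      ∂(gammaMeasure r lam).prod (gaussianReal 0 v) := by
  have := isProbabilityMeasure_gammaMeasure hr hlam
  have hv0 : (v : ℝ) ≠ 0 := by exact_mod_cast hv.ne'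
  have c1 : Continuous f₁ := continuous_iff_continuousAt.2 fun y => (d1 y).continuousAt
  have c2 : Continuous f₂ := continuous_iff_continuousAt.2 fun y => (d2 y).continuousAt
  have iG1 : Integrable (fun z : ℝ × ℝ => z.1 * f₁ (z.1 * z.2))
      ((gammaMeasure r lam).prod (gaussianReal 0 v)) := by
    simpa using integrable_gamma_gaussian_pow_mul hr hlam hv c1.measurable i10 i12
      (n := 1) (by norm_num)
  have iG2 := integrable_gamma_gaussian_pow_mul hr hlam hv c1.measurable i10 i12
    (n := 2) (by norm_num)
  have iGY := integrable_gamma_gaussian_mul_mul hr hlam hv c2.measurable i20 i22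
  have hgauss : ∫ z, (z.1 * z.2) * f (z.1 * z.2) ∂(gammaMeasure r lam).prod (gaussianReal 0 v) =
      v * ∫ z, z.1 ^ 2 * f₁ (z.1 * z.2) ∂(gammaMeasure r lam).prod (gaussianReal 0 v) := by
    rw [integral_prod _ i01, integral_prod _ iG2, ← integral_const_mul]
    refine integral_congr_ae ?_
    filter_upwards [i00.prod_right_ae, i01.prod_right_ae, i10.prod_right_ae] with g a0 a1 a2
    rcases eq_or_ne g 0 with rfl | hg
    · simp
    have b1 : Integrable (fun x => x * f (g * x)) (gaussianReal 0 v) := by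
      refine (a1.const_mul g⁻¹).congr (ae_of_all _ fun x => ?_)
      field_simp
    have := integral_gaussianReal_stein hv.ne' (k := fun x => f (g * x))
      (k' := fun x => g * f₁ (g * x)) (fun x => ?_) a0 b1 (a2.const_mul g)
    · simp only [mul_assoc, integral_const_mul] at this ⊢
      rw [this]
      ring
    · have dg : HasDerivAt (fun x => g * x) g x := by
        simpa using (hasDerivAt_id x).const_mul g
      exact ((d0 (g * x)).comp x dg).congr_deriv (mul_comm _ _)
  have iL : Integrable (fun z : ℝ × ℝ => (z.1 * z.2) ^ 2 * f₃ (z.1 * z.2)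
      + 2 * (r + 1) * ((z.1 * z.2) * f₂ (z.1 * z.2)) + r * (r + 1) * f₁ (z.1 * z.2))
      ((gammaMeasure r lam).prod (gaussianReal 0 v)) :=
    (i32.add (i21.const_mul _)).add (i10.const_mul _)
  rw [hgauss, ← mul_assoc, div_mul_cancel₀ _ hv0, ← integral_const_mul,
    integral_prod_symm _ iL, integral_prod_symm _ (iG2.const_mul _)]
  refine integral_congr_ae ?_
  filter_upwards [i10.prod_left_ae, iG1.prod_left_ae, iG2.prod_left_ae, i21.prod_left_ae,
    iGY.prod_left_ae, i32.prod_left_ae] with x a0 a1 a2 b1 b2 e2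
  have dx : ∀ g : ℝ, HasDerivAt (fun g => g * x) x g := fun g => by
    simpa using (hasDerivAt_id g).mul_const x
  have := integral_gammaMeasure_stein hr hlam (h := fun g => f₁ (g * x))
    (h₁ := fun g => x * f₂ (g * x)) (h₂ := fun g => x ^ 2 * f₃ (g * x))
    (fun g => ((d1 (g * x)).comp g (dx g)).congr_deriv (mul_comm _ _))
    (fun g => by
      refine (((d2 (g * x)).comp g (dx g)).const_mul x).congr_deriv ?_
      ring)
    a0 a1 a2 (b1.congr (ae_of_all _ fun g => by ring)) (b2.congr (ae_of_all _ fun g => by ring))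
    (e2.congr (ae_of_all _ fun g => by ring))
  rw [← this]
  refine integral_congr_ae (ae_of_all _ fun g => ?_)
  simp only
  ring

end Forward

end ProductLaw

section CharacteristicODE

/-- Uniqueness for the characteristic equation, as an energy is nonincreasing on the half line. -/
lemma eq_zero_of_ode_of_nonneg {r a : ℝ} (hr : 0 < r) (ha : 0 < a) {w w₁ w₂ : ℝ → ℝ}
    (d0 : ∀ t, HasDerivAt w (w₁ t) t) (d1 : ∀ t, HasDerivAt w₁ (w₂ t) t)
    (hode : ∀ t, t ^ 3 * w₂ t + (2 * (r + 1) * t ^ 2 + a) * w₁ t + r * (r + 1) * t * w t = 0)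
    (h0 : w 0 = 0) {t : ℝ} (ht : 0 ≤ t) : w t = 0 := by
  have dE : ∀ s, HasDerivAt (fun s => s ^ 2 * w₁ s ^ 2 + r * (r + 1) * w s ^ 2)
      (2 * s * w₁ s ^ 2 + s ^ 2 * (2 * w₁ s * w₂ s) + r * (r + 1) * (2 * w s * w₁ s)) s := by
    intro s
    refine ((((hasDerivAt_id s).pow 2).mul ((d1 s).pow 2)).add
      (((d0 s).pow 2).const_mul (r * (r + 1)))).congr_deriv ?_
    simp
  have hanti : AntitoneOn (fun s => s ^ 2 * w₁ s ^ 2 + r * (r + 1) * w s ^ 2) (Set.Ici 0) := by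
    refine antitoneOn_of_deriv_nonpos (convex_Ici 0)
      (fun s _ => (dE s).continuousAt.continuousWithinAt)
      (fun s _ => (dE s).differentiableAt.differentiableWithinAt) fun s hs => ?_
    rw [interior_Ici] at hs
    have hs : 0 < s := hs
    rw [(dE s).deriv]
    refine nonpos_of_mul_nonpos_right (a := s) ?_ hs
    have e : s * (2 * s * w₁ s ^ 2 + s ^ 2 * (2 * w₁ s * w₂ s) + r * (r + 1) * (2 * w s * w₁ s)) =
        -(2 * ((2 * r + 1) * s ^ 2 + a) * w₁ s ^ 2) := by
      linear_combination 2 * w₁ s * hode s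
    rw [e, neg_nonpos]
    positivity
  have hE := hanti (Set.mem_Ici.2 le_rfl) (Set.mem_Ici.2 ht) ht
  simp only [h0] at hE
  have h1 : 0 ≤ t ^ 2 * w₁ t ^ 2 := by positivity
  have h2 : r * (r + 1) * w t ^ 2 ≤ 0 := by nlinarith
  have h3 : 0 < r * (r + 1) := by positivity
  exact pow_eq_zero_iff two_ne_zero |>.1 (le_antisymm (nonpos_of_mul_nonpos_right h2 h3)
    (sq_nonneg _))

lemma eq_zero_of_ode {r a : ℝ} (hr : 0 < r) (ha : 0 < a) {w w₁ w₂ : ℝ → ℝ}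
    (d0 : ∀ t, HasDerivAt w (w₁ t) t) (d1 : ∀ t, HasDerivAt w₁ (w₂ t) t)
    (hode : ∀ t, t ^ 3 * w₂ t + (2 * (r + 1) * t ^ 2 + a) * w₁ t + r * (r + 1) * t * w t = 0)
    (h0 : w 0 = 0) (t : ℝ) : w t = 0 := by
  rcases le_total 0 t with ht | ht
  · exact eq_zero_of_ode_of_nonneg hr ha d0 d1 hode h0 ht
  · have := eq_zero_of_ode_of_nonneg hr ha (w := fun s => w (-s)) (w₁ := fun s => -w₁ (-s))
      (w₂ := fun s => w₂ (-s))
      (fun s => ((d0 (-s)).comp s (hasDerivAt_neg s)).congr_deriv (by ring))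
      (fun s => ((d1 (-s)).comp s (hasDerivAt_neg s)).neg.congr_deriv (by ring))
      (fun s => by linear_combination -hode (-s)) (by simpa using h0) (t := -t) (by linarith)
    simpa using this

variable {Ω : Type*} [MeasurableSpace Ω] {P : Measure Ω} {Y : Ω → ℝ}

lemma integrable_mul_comp_of_bounded {Z : Ω → ℝ} (hZ : Integrable Z P) (hY : AEMeasurable Y P)
    {φ : ℝ → ℝ} (hφ : Continuous φ) {C : ℝ} (hC : ∀ y, |φ y| ≤ C) :
    Integrable (fun ω => Z ω * φ (Y ω)) P :=
  hZ.mul_bdd (c := C) (hφ.measurable.comp_aemeasurable hY).aestronglyMeasurable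
    (ae_of_all _ fun ω => hC (Y ω))

lemma hasDerivAt_integral_mul_cos (hY : Integrable Y P) (hY2 : Integrable (fun ω => Y ω ^ 2) P)
    (b t : ℝ) :
    HasDerivAt (fun t => ∫ ω, Y ω * Real.cos (t * Y ω + b) ∂P)
      (∫ ω, -(Y ω ^ 2 * Real.sin (t * Y ω + b)) ∂P) t := by
  have hm := hY.aestronglyMeasurable.aemeasurable
  refine (hasDerivAt_integral_of_dominated_loc_of_deriv_le (μ := P)
    (F := fun t ω => Y ω * Real.cos (t * Y ω + b))
    (F' := fun t ω => -(Y ω ^ 2 * Real.sin (t * Y ω + b)))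
    (bound := fun ω => Y ω ^ 2) (s := Set.univ) Filter.univ_mem
    (Filter.Eventually.of_forall fun s => ?_) ?_ ?_
    (ae_of_all _ fun ω s _ => ?_) hY2 (ae_of_all _ fun ω s _ => ?_)).2
  · exact AEMeasurable.aestronglyMeasurable (by fun_prop)
  · exact integrable_mul_comp_of_bounded hY hm
      (φ := fun y => Real.cos (t * y + b)) (by fun_prop) (fun y => Real.abs_cos_le_one _)
  · exact AEMeasurable.aestronglyMeasurable (by fun_prop)
  · rw [norm_neg, norm_mul, Real.norm_of_nonneg (sq_nonneg _)]
    exact mul_le_of_le_one_right (sq_nonneg _) (Real.abs_sin_le_one _)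
  · refine ((((hasDerivAt_id s).mul_const (Y ω)).add_const b).cos.const_mul (Y ω)).congr_deriv ?_
    simp only [id]
    ring

variable [IsProbabilityMeasure P]

lemma integrable_sin_affine (hm : AEMeasurable Y P) (t b : ℝ) :
    Integrable (fun ω => Real.sin (t * Y ω + b)) P := by
  simpa using integrable_mul_comp_of_bounded (integrable_const (1 : ℝ)) hm
    (φ := fun y => Real.sin (t * y + b)) (by fun_prop) (fun y => Real.abs_sin_le_one _)

lemma hasDerivAt_integral_sin (hY : Integrable Y P) (b t : ℝ) :
    HasDerivAt (fun t => ∫ ω, Real.sin (t * Y ω + b) ∂P)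
      (∫ ω, Y ω * Real.cos (t * Y ω + b) ∂P) t := by
  have hm := hY.aestronglyMeasurable.aemeasurable
  refine (hasDerivAt_integral_of_dominated_loc_of_deriv_le (μ := P)
    (F := fun t ω => Real.sin (t * Y ω + b)) (F' := fun t ω => Y ω * Real.cos (t * Y ω + b))
    (bound := fun ω => |Y ω|) (s := Set.univ) Filter.univ_mem
    (Filter.Eventually.of_forall fun s => ?_) ?_ ?_
    (ae_of_all _ fun ω s _ => ?_) hY.abs (ae_of_all _ fun ω s _ => ?_)).2
  · exact AEMeasurable.aestronglyMeasurable (by fun_prop)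
  · exact integrable_sin_affine hm t b
  · exact AEMeasurable.aestronglyMeasurable (by fun_prop)
  · rw [norm_mul]
    exact mul_le_of_le_one_right (norm_nonneg _) (Real.abs_cos_le_one _)
  · refine (((hasDerivAt_id s).mul_const (Y ω)).add_const b).sin.congr_deriv ?_
    simp [mul_comm]

lemma iteratedDeriv_cos_affine (t b : ℝ) :
    iteratedDeriv 1 (fun y => Real.cos (t * y + b)) = (fun y => -t * Real.sin (t * y + b)) ∧
    iteratedDeriv 2 (fun y => Real.cos (t * y + b)) = (fun y => -t ^ 2 * Real.cos (t * y + b)) ∧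
    iteratedDeriv 3 (fun y => Real.cos (t * y + b)) = (fun y => t ^ 3 * Real.sin (t * y + b)) := by
  have dl : ∀ y, HasDerivAt (fun y => t * y + b) t y := fun y => by
    simpa using ((hasDerivAt_id y).const_mul t).add_const b
  have h1 : iteratedDeriv 1 (fun y => Real.cos (t * y + b)) =
      fun y => -t * Real.sin (t * y + b) := by
    rw [iteratedDeriv_one]
    exact funext fun y => ((dl y).cos.congr_deriv (by ring)).deriv
  have h2 : iteratedDeriv 2 (fun y => Real.cos (t * y + b)) =
      fun y => -t ^ 2 * Real.cos (t * y + b) := by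
    rw [iteratedDeriv_succ, h1]
    exact funext fun y => (((dl y).sin.const_mul (-t)).congr_deriv (by ring)).deriv
  refine ⟨h1, h2, ?_⟩
  rw [iteratedDeriv_succ, h2]
  exact funext fun y => (((dl y).cos.const_mul (-t ^ 2)).congr_deriv (by ring)).deriv

lemma cos_affine_mem_steinClass (hm : AEMeasurable Y P) (hY : Integrable Y P)
    (hY2 : Integrable (fun ω => Y ω ^ 2) P) (t b : ℝ) :
    (fun y => Real.cos (t * y + b)) ∈ steinClass 3 2 P Y := by
  refine ⟨by fun_prop, fun n hn j hj => ?_⟩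
  have hZ : Integrable (fun ω => Y ω ^ j) P := by
    interval_cases j
    · simp
    · simpa using hY
    · exact hY2
  obtain ⟨h1, h2, h3⟩ := iteratedDeriv_cos_affine t b
  have hs : ∀ c y : ℝ, |c * Real.sin (t * y + b)| ≤ |c| := fun c y => by
    rw [abs_mul]; exact mul_le_of_le_one_right (abs_nonneg c) (Real.abs_sin_le_one _)
  have hc : ∀ c y : ℝ, |c * Real.cos (t * y + b)| ≤ |c| := fun c y => by
    rw [abs_mul]; exact mul_le_of_le_one_right (abs_nonneg c) (Real.abs_cos_le_one _)
  interval_cases n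
  · rw [iteratedDeriv_zero]
    exact integrable_mul_comp_of_bounded hZ hm (φ := fun y => Real.cos (t * y + b))
      (by fun_prop) fun y => Real.abs_cos_le_one _
  · rw [h1]
    exact integrable_mul_comp_of_bounded hZ hm (φ := fun y => -t * Real.sin (t * y + b))
      (by fun_prop) (hs _)
  · rw [h2]
    exact integrable_mul_comp_of_bounded hZ hm (φ := fun y => -t ^ 2 * Real.cos (t * y + b))
      (by fun_prop) (hc _)
  · rw [h3]
    exact integrable_mul_comp_of_bounded hZ hm (φ := fun y => t ^ 3 * Real.sin (t * y + b))
      (by fun_prop) (hs _)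

lemma ode_of_integral_steinOp_eq_zero {r lam v : ℝ} (hY : Integrable Y P)
    (hY2 : Integrable (fun ω => Y ω ^ 2) P) (t b : ℝ)
    (h : ∫ ω, steinOpGammaGauss r lam v (fun y => Real.cos (t * y + b)) (Y ω) ∂P = 0) :
    t ^ 3 * (∫ ω, -(Y ω ^ 2 * Real.sin (t * Y ω + b)) ∂P)
      + (2 * (r + 1) * t ^ 2 + lam ^ 2 / v) * (∫ ω, Y ω * Real.cos (t * Y ω + b) ∂P)
      + r * (r + 1) * t * (∫ ω, Real.sin (t * Y ω + b) ∂P) = 0 := by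
  have hm := hY.aestronglyMeasurable.aemeasurable
  obtain ⟨h1, h2, h3⟩ := iteratedDeriv_cos_affine t b
  have i0 := integrable_sin_affine hm t b
  have i1 : Integrable (fun ω => Y ω * Real.cos (t * Y ω + b)) P :=
    integrable_mul_comp_of_bounded hY hm
      (φ := fun y => Real.cos (t * y + b)) (by fun_prop) (fun y => Real.abs_cos_le_one _)
  have i2 : Integrable (fun ω => -(Y ω ^ 2 * Real.sin (t * Y ω + b))) P :=
    (integrable_mul_comp_of_bounded hY2 hm
      (φ := fun y => Real.sin (t * y + b)) (by fun_prop) (fun y => Real.abs_sin_le_one _)).neg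
  rw [← integral_const_mul, ← integral_const_mul, ← integral_const_mul,
    ← integral_add (i2.const_mul _) (i1.const_mul _),
    ← integral_add (by exact (i2.const_mul _).add (i1.const_mul _)) (i0.const_mul _),
    ← neg_eq_zero, ← integral_neg, ← h]
  refine integral_congr_ae (ae_of_all _ fun ω => ?_)
  simp only [steinOpGammaGauss, h1, h2, h3]
  ring

lemma charFun_map_eq_integral_cos_sin (hm : AEMeasurable Y P) (t : ℝ) :
    charFun (P.map Y) t = ((∫ ω, Real.sin (t * Y ω + Real.pi / 2) ∂P : ℝ) : ℂ)
      + ((∫ ω, Real.sin (t * Y ω + 0) ∂P : ℝ) : ℂ) * Complex.I := by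
  have i : ∀ b : ℝ, Integrable (fun ω => ((Real.sin (t * Y ω + b) : ℝ) : ℂ)) P :=
    fun b => (integrable_sin_affine hm t b).ofReal
  rw [charFun_apply_real, integral_map hm (Continuous.aestronglyMeasurable (by fun_prop)),
    ← integral_complex_ofReal, ← integral_complex_ofReal, ← integral_mul_const,
    ← integral_add (i _) ((i 0).mul_const _)]
  refine integral_congr_ae (ae_of_all _ fun ω => ?_)
  simp only [add_zero, Real.sin_add_pi_div_two]
  rw [Complex.exp_mul_I]
  push_cast
  rfl

lemma map_eq_of_integral_steinOp_eq_zero {Ω' : Type*} [MeasurableSpace Ω'] {Q : Measure Ω'}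
    [IsProbabilityMeasure Q] {W : Ω' → ℝ} {r lam v : ℝ} (hr : 0 < r) (hlam : 0 < lam) (hv : 0 < v)
    (hY : Integrable Y P) (hY2 : Integrable (fun ω => Y ω ^ 2) P)
    (hW : Integrable W Q) (hW2 : Integrable (fun ω => W ω ^ 2) Q)
    (hP : ∀ t b, ∫ ω, steinOpGammaGauss r lam v (fun y => Real.cos (t * y + b)) (Y ω) ∂P = 0)
    (hQ : ∀ t b, ∫ ω, steinOpGammaGauss r lam v (fun y => Real.cos (t * y + b)) (W ω) ∂Q = 0) :
    Q.map W = P.map Y := by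
  have hYm := hY.aestronglyMeasurable.aemeasurable
  have hWm := hW.aestronglyMeasurable.aemeasurable
  have := Measure.isProbabilityMeasure_map hYm
  have := Measure.isProbabilityMeasure_map hWm
  have key : ∀ b t, ∫ ω, Real.sin (t * W ω + b) ∂Q = ∫ ω, Real.sin (t * Y ω + b) ∂P := by
    intro b t
    refine sub_eq_zero.1 (eq_zero_of_ode hr (by positivity : 0 < lam ^ 2 / v)
      (fun s => (hasDerivAt_integral_sin hW b s).sub (hasDerivAt_integral_sin hY b s))
      (fun s => (hasDerivAt_integral_mul_cos hW hW2 b s).sub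
        (hasDerivAt_integral_mul_cos hY hY2 b s)) (fun s => ?_) (by simp) t)
    simp only [Pi.sub_apply]
    linear_combination ode_of_integral_steinOp_eq_zero hW hW2 s b (hQ s b)
      - ode_of_integral_steinOp_eq_zero hY hY2 s b (hP s b)
  refine Measure.ext_of_charFun (funext fun t => ?_)
  rw [charFun_map_eq_integral_cos_sin hWm, charFun_map_eq_integral_cos_sin hYm, key, key]

end CharacteristicODE

section SteinCharacterisation

lemma ContDiff.hasDerivAt_iteratedDeriv {f : ℝ → ℝ} {n m : ℕ} (hf : ContDiff ℝ n f) (hm : m < n)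
    (y : ℝ) : HasDerivAt (iteratedDeriv m f) (iteratedDeriv (m + 1) f y) y := by
  rw [iteratedDeriv_succ]
  exact (hf.differentiable_iteratedDeriv m (by exact_mod_cast hm) y).hasDerivAt

lemma measurable_steinOpGammaGauss (r lam v : ℝ) {f : ℝ → ℝ} (hf : ContDiff ℝ (3 : ℕ) f) :
    Measurable (steinOpGammaGauss r lam v f) := by
  have h : ∀ m ≤ 3, Measurable (iteratedDeriv m f) := fun m hm =>
    (hf.continuous_iteratedDeriv m (by exact_mod_cast hm)).measurable
  have h0 := hf.continuous.measurable
  have h1 := h 1 (by norm_num)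
  have h2 := h 2 (by norm_num)
  have h3 := h 3 (by norm_num)
  unfold steinOpGammaGauss
  fun_prop

variable {Ω : Type*} [MeasurableSpace Ω] {P : Measure Ω} [IsProbabilityMeasure P]
  {r lam : ℝ} {v : ℝ≥0} {G X : Ω → ℝ}

lemma integrable_mul_pow_of_gamma_gaussian (hr : 0 < r) (hlam : 0 < lam)
    (hG : HasLaw G (gammaMeasure r lam) P) (hX : HasLaw X (gaussianReal 0 v) P)
    (hGX : IndepFun G X P) (n : ℕ) : Integrable (fun ω => (G ω * X ω) ^ n) P := by
  have := isProbabilityMeasure_gammaMeasure hr hlam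
  have hlaw := (indepFun_iff_hasLaw_prodMk_prod hG hX).1 hGX
  have hXn : Integrable (fun x : ℝ => x ^ n) (gaussianReal 0 v) := by
    have := (memLp_id_gaussianReal (μ := 0) (v := v) n).integrable_norm_pow'
    exact (integrable_norm_iff (by fun_prop)).1 (by simpa using this)
  have h := (integrable_pow_gammaMeasure hr hlam n).mul_prod hXn
  rw [← hlaw.map_eq] at h
  simpa only [mul_pow, Function.comp_def] using h.comp_aemeasurable hlaw.aemeasurable

lemma integral_steinOp_gamma_gaussian (hr : 0 < r) (hlam : 0 < lam) (hv : 0 < v)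
    (hG : HasLaw G (gammaMeasure r lam) P) (hX : HasLaw X (gaussianReal 0 v) P)
    (hGX : IndepFun G X P) {f : ℝ → ℝ} (hf : f ∈ steinClass 3 2 P (fun ω => G ω * X ω)) :
    Integrable (fun ω => steinOpGammaGauss r lam v f (G ω * X ω)) P ∧
      ∫ ω, steinOpGammaGauss r lam v f (G ω * X ω) ∂P = 0 := by
  obtain ⟨hf, hint⟩ := hf
  have := isProbabilityMeasure_gammaMeasure hr hlam
  have hlaw := (indepFun_iff_hasLaw_prodMk_prod hG hX).1 hGX
  have hm : ∀ m ≤ 3, Measurable (iteratedDeriv m f) := fun m hm =>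
    (hf.continuous_iteratedDeriv m (by exact_mod_cast hm)).measurable
  have key : ∀ t ≤ 3, ∀ j ≤ 2,
      Integrable (fun z : ℝ × ℝ => (z.1 * z.2) ^ j * iteratedDeriv t f (z.1 * z.2))
        ((gammaMeasure r lam).prod (gaussianReal 0 v)) := fun t ht j hj => by
    have := hm t ht
    rw [← hlaw.map_eq, integrable_map_measure (Measurable.aestronglyMeasurable (by fun_prop))
      hlaw.aemeasurable]
    exact hint t ht j hj
  have hS : Integrable (fun z : ℝ × ℝ => (z.1 * z.2) ^ 2 * iteratedDeriv 3 f (z.1 * z.2)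
      + 2 * (r + 1) * ((z.1 * z.2) ^ 1 * iteratedDeriv 2 f (z.1 * z.2))
      + r * (r + 1) * ((z.1 * z.2) ^ 0 * iteratedDeriv 1 f (z.1 * z.2)))
        ((gammaMeasure r lam).prod (gaussianReal 0 v)) :=
    ((key 3 le_rfl 2 le_rfl).add ((key 2 (by norm_num) 1 (by norm_num)).const_mul _)).add
      ((key 1 (by norm_num) 0 (by norm_num)).const_mul _)
  have hT := (key 0 (by norm_num) 1 (by norm_num)).const_mul (lam ^ 2 / (v : ℝ))
  have heq : ∀ z : ℝ × ℝ, steinOpGammaGauss r lam v f (z.1 * z.2) =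
      ((z.1 * z.2) ^ 2 * iteratedDeriv 3 f (z.1 * z.2)
      + 2 * (r + 1) * ((z.1 * z.2) ^ 1 * iteratedDeriv 2 f (z.1 * z.2))
      + r * (r + 1) * ((z.1 * z.2) ^ 0 * iteratedDeriv 1 f (z.1 * z.2)))
      - lam ^ 2 / v * ((z.1 * z.2) ^ 1 * iteratedDeriv 0 f (z.1 * z.2)) := fun z => by
    simp only [steinOpGammaGauss, iteratedDeriv_zero]
    ring
  have hI : Integrable (fun z : ℝ × ℝ => steinOpGammaGauss r lam v f (z.1 * z.2))
      ((gammaMeasure r lam).prod (gaussianReal 0 v)) :=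
    (hS.sub hT).congr (ae_of_all _ fun z => (heq z).symm)
  have h0 : ∫ z : ℝ × ℝ, steinOpGammaGauss r lam v f (z.1 * z.2)
      ∂(gammaMeasure r lam).prod (gaussianReal 0 v) = 0 := by
    have k : ∀ t ≤ 3, Integrable (fun z : ℝ × ℝ => iteratedDeriv t f (z.1 * z.2))
        ((gammaMeasure r lam).prod (gaussianReal 0 v)) := fun t ht => by
      simpa using key t ht 0 (by norm_num)
    have k' : ∀ t ≤ 3, Integrable (fun z : ℝ × ℝ => (z.1 * z.2) * iteratedDeriv t f (z.1 * z.2))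
        ((gammaMeasure r lam).prod (gaussianReal 0 v)) := fun t ht => by
      simpa using key t ht 1 (by norm_num)
    simp only [heq]
    rw [integral_sub hS hT, integral_const_mul, sub_eq_zero]
    simp only [pow_one, pow_zero, one_mul]
    exact integral_gamma_gaussian_stein hr hlam hv
      (hf.hasDerivAt_iteratedDeriv (by norm_num)) (hf.hasDerivAt_iteratedDeriv (by norm_num))
      (hf.hasDerivAt_iteratedDeriv (by norm_num))
      (k 0 (by norm_num)) (k' 0 (by norm_num)) (k 1 (by norm_num))
      (key 1 (by norm_num) 2 le_rfl) (k 2 (by norm_num)) (k' 2 (by norm_num))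
      (key 2 (by norm_num) 2 le_rfl) (key 3 le_rfl 2 le_rfl)
  refine ⟨?_, ?_⟩
  · rw [← hlaw.map_eq] at hI
    exact hI.comp_aemeasurable hlaw.aemeasurable
  · rw [← h0]
    exact hlaw.integral_comp hI.aestronglyMeasurable

end SteinCharacterisation

theorem stein_characterisation_gamma_times_gaussian
    {Ω Ω' : Type*} [MeasurableSpace Ω] [MeasurableSpace Ω']
    (P : Measure Ω) [IsProbabilityMeasure P] (Q : Measure Ω') [IsProbabilityMeasure Q]
    (r lam : ℝ) (v : ℝ≥0) (hr : 0 < r) (hlam : 0 < lam) (hv : 0 < v)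
    (G X : Ω → ℝ) (hG : HasLaw G (gammaMeasure r lam) P) (hX : HasLaw X (gaussianReal 0 v) P)
    (hGX : IndepFun G X P)
    (W : Ω' → ℝ) (hW : AEMeasurable W Q) (hW2 : Integrable (fun ω => W ω ^ 2) Q) :
    IdentDistrib W (fun ω => G ω * X ω) Q P ↔
      ∀ f ∈ steinClass 3 2 P (fun ω => G ω * X ω),
        Integrable (fun ω => steinOpGammaGauss r lam v f (W ω)) Q ∧
          ∫ ω, steinOpGammaGauss r lam v f (W ω) ∂Q = 0 := by
  have hYm : AEMeasurable (fun ω => G ω * X ω) P := hG.aemeasurable.mul hX.aemeasurable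
  constructor
  · intro hid f hf
    have hS := hid.comp (measurable_steinOpGammaGauss r lam v hf.1)
    obtain ⟨hi, h0⟩ := integral_steinOp_gamma_gaussian hr hlam hv hG hX hGX hf
    exact ⟨hS.integrable_iff.2 hi, hS.integral_eq.trans h0⟩
  · intro h
    have hY2 := integrable_mul_pow_of_gamma_gaussian hr hlam hG hX hGX 2
    have hY : Integrable (fun ω => G ω * X ω) P := by
      simpa using integrable_mul_pow_of_gamma_gaussian hr hlam hG hX hGX 1
    have hW1 : Integrable W Q :=
      ((memLp_two_iff_integrable_sq hW.aestronglyMeasurable).2 hW2).integrable (by norm_num)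
    have hmem := cos_affine_mem_steinClass hYm hY hY2
    exact ⟨hW, hYm, map_eq_of_integral_steinOp_eq_zero hr hlam hv hY hY2 hW1 hW2
      (fun t b => (integral_steinOp_gamma_gaussian hr hlam hv hG hX hGX (hmem t b)).2)
      (fun t b => (h _ (hmem t b)).2)⟩
end
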